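/- There is a constant C > 0 such that for every m ≥ 0, every n ≥ 1, and all a, a' ∈ [-2, 1/4] with a ≤ a' and h(a), h(a') ∈ [2^{−m−1} log 2, 2^{−m} log 2]: if |h(a) − h(a')| > C · 2^{−m} · 2^{−n/2}, then there exists b̂ ∈ (1,2] such that the turning point 0 is periodic under T_{b̂} with minimal period at most 2^m n and h^{-1}({log b̂}) ⊆ [a, a']. -/

import Mathlib

open Filter Set MeasureTheory

/-- The quadratic family `f_a(x) = x² + a`. -/
noncomputable def fa (a : ℝ) : ℝ → ℝ := fun x => x ^ 2 + a

/-- The invariant interval `I_a`. -/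
noncomputable def Ia (a : ℝ) : Set ℝ :=
  Set.Icc ((-1 - Real.sqrt (1 - 4 * a)) / 2) ((1 + Real.sqrt (1 - 4 * a)) / 2)

/-- Topological entropy of `f_a` restricted to `I_a`. -/
noncomputable def h (a : ℝ) : ℝ := (Dynamics.coverEntropy (fa a) (Ia a)).toReal

/-- The tent map `T_b(x) = 1 − b|x|`. -/
noncomputable def tent (b : ℝ) : ℝ → ℝ := fun x => 1 - b * |x|

lemma abs_tent_le_one {b x : ℝ} (hb : b ∈ Icc (1 : ℝ) 2) (hx : |x| ≤ 1) : |tent b x| ≤ 1 := by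
  have h0 := abs_nonneg x
  obtain ⟨h1, h2⟩ := hb
  simp only [tent]
  rw [abs_le]
  constructor <;> nlinarith

lemma abs_tent_iterate_le_one {b : ℝ} (hb : b ∈ Icc (1 : ℝ) 2) (k : ℕ) :
    |(tent b)^[k] 0| ≤ 1 := by
  induction k with
  | zero => simp
  | succ k ih =>
    rw [Function.iterate_succ_apply']
    exact abs_tent_le_one hb ih

lemma continuous_tent_iterate (k : ℕ) : Continuous fun b : ℝ => (tent b)^[k] 0 := by
  induction k with
  | zero => simpa using continuous_const
  | succ k ih =>
    simp only [Function.iterate_succ_apply', tent] at ih ⊢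
    fun_prop

lemma tent_iterate_dist_step {b b' : ℝ} (hb : 0 ≤ b) (hbb : b ≤ b') {k : ℕ}
    (hs : 0 < (tent b)^[k] 0 * (tent b')^[k] 0) :
    b' * |(tent b')^[k] 0 - (tent b)^[k] 0| - (b' - b) * |(tent b)^[k] 0| ≤
      |(tent b')^[k + 1] 0 - (tent b)^[k + 1] 0| := by
  rw [Function.iterate_succ_apply', Function.iterate_succ_apply']
  set x := (tent b)^[k] 0
  set y := (tent b')^[k] 0
  simp only [tent]
  have hxy : |y - x| = |(|y| - |x|)| := by
    rcases pos_and_pos_or_neg_and_neg_of_mul_pos hs with ⟨h1, h2⟩ | ⟨h1, h2⟩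
    · rw [abs_of_pos h1, abs_of_pos h2]
    · rw [abs_of_neg h1, abs_of_neg h2, abs_sub_comm]
      congr 1
      ring
  have h1 : 1 - b' * |y| - (1 - b * |x|) = -(b' * (|y| - |x|) + (b' - b) * |x|) := by ring
  rw [h1, abs_neg, hxy]
  have h2 := abs_sub_abs_le_abs_sub (b' * (|y| - |x|)) (-((b' - b) * |x|))
  rw [sub_neg_eq_add, abs_neg, abs_mul, abs_of_nonneg (hb.trans hbb), abs_mul, abs_abs,
    abs_of_nonneg (sub_nonneg.2 hbb)] at h2
  exact h2

lemma tent_iterate_expansion_step {b b' e : ℝ} (hb : 1 < b) (hbb : b ≤ b') (hb' : b' ≤ 2) {k : ℕ}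
    (hs : 0 < (tent b)^[k] 0 * (tent b')^[k] 0)
    (hk : (b' - b) * (1 / (b' - 1) + e) ≤ |(tent b')^[k] 0 - (tent b)^[k] 0|) :
    (b' - b) * (1 / (b' - 1) + b' * e) ≤ |(tent b')^[k + 1] 0 - (tent b)^[k + 1] 0| := by
  have h1 := tent_iterate_dist_step (by linarith) hbb hs
  have h2 := abs_tent_iterate_le_one (b := b) ⟨hb.le, hbb.trans hb'⟩ k
  have h3 : b' * (1 / (b' - 1)) - 1 = 1 / (b' - 1) := by
    have : b' - 1 ≠ 0 := by linarith
    field_simp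
    ring
  have h4 : (b' - b) * (1 / (b' - 1) + b' * e) =
      b' * ((b' - b) * (1 / (b' - 1) + e)) - (b' - b) * 1 := by
    rw [← h3]
    ring_nf
    have : -1 + b' ≠ 0 := by linarith
    field_simp
    ring
  rw [h4]
  refine le_trans ?_ h1
  have h5 : b' * ((b' - b) * (1 / (b' - 1) + e)) ≤ b' * |(tent b')^[k] 0 - (tent b)^[k] 0| :=
    mul_le_mul_of_nonneg_left hk (by linarith)
  have h6 : (b' - b) * |(tent b)^[k] 0| ≤ (b' - b) * 1 :=
    mul_le_mul_of_nonneg_left h2 (by linarith)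
  linarith

lemma tent_iterate_two {b : ℝ} : (tent b)^[2] 0 = 1 - b := by simp [tent]

lemma tent_iterate_three {b : ℝ} (hb : 1 ≤ b) : (tent b)^[3] 0 = 1 + b - b ^ 2 := by
  rw [Function.iterate_succ_apply', tent_iterate_two, tent, abs_of_nonpos (by linarith)]
  ring

lemma tent_iterate_expansion_five {b b' : ℝ} (hb : √2 ≤ b) (hbb : b ≤ b') (hb' : b' ≤ 2)
    (hs : ∀ k ∈ Icc 1 4, 0 < (tent b)^[k] 0 * (tent b')^[k] 0) :
    (b' - b) * (1 / (b' - 1) + 1 / 5) ≤ |(tent b')^[5] 0 - (tent b)^[5] 0| := by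
  have hs2 : (1.4142 : ℝ) ≤ √2 := Real.le_sqrt_of_sq_le (by norm_num)
  have hb1 : 1 < b := by linarith
  have hδ : 0 ≤ b' - b := by linarith
  have hA : 1 / (b' - 1) ≤ 1 / (b - 1) :=
    one_div_le_one_div_of_le (by linarith) (by linarith)
  have h3 := tent_iterate_three hb1.le
  have h3' := tent_iterate_three (hb1.le.trans hbb)
  rcases le_or_gt 1.55 b with hc | hc
  · have hA2 : 1 / (b - 1) ≤ 1.82 := by
      rw [div_le_iff₀ (by linarith)]
      linarith
    have e3 : (b' - b) * (1 / (b' - 1) + 1 / 5) ≤ |(tent b')^[3] 0 - (tent b)^[3] 0| := by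
      rw [h3, h3', show 1 + b' - b' ^ 2 - (1 + b - b ^ 2) = -((b' - b) * (b + b' - 1)) by ring,
        abs_neg]
      refine le_trans ?_ (le_abs_self _)
      apply mul_le_mul_of_nonneg_left _ hδ
      linarith
    have e4 := tent_iterate_expansion_step hb1 hbb hb' (hs 3 ⟨by norm_num, by norm_num⟩) e3
    have e5 := tent_iterate_expansion_step hb1 hbb hb' (hs 4 ⟨by norm_num, by norm_num⟩) e4
    refine le_trans ?_ e5
    apply mul_le_mul_of_nonneg_left _ hδ
    nlinarith
  · have p3 := hs 3 ⟨by norm_num, by norm_num⟩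
    have q3 : 0 < (tent b)^[3] 0 := by
      rw [h3]
      nlinarith
    have q3' : 0 < (tent b')^[3] 0 := by
      by_contra hn
      push Not at hn
      nlinarith
    have h4 : (tent b)^[4] 0 = 1 - b - b ^ 2 + b ^ 3 := by
      rw [Function.iterate_succ_apply', tent, abs_of_pos q3, h3]
      ring
    have h4' : (tent b')^[4] 0 = 1 - b' - b' ^ 2 + b' ^ 3 := by
      rw [Function.iterate_succ_apply', tent, abs_of_pos q3', h3']
      ring
    have e4 : (b' - b) * (3 * b ^ 2 - 2 * b - 1) ≤ |(tent b')^[4] 0 - (tent b)^[4] 0| := by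
      rw [h4, h4', show 1 - b' - b' ^ 2 + b' ^ 3 - (1 - b - b ^ 2 + b ^ 3) =
        (b' - b) * (b ^ 2 + b * b' + b' ^ 2 - b - b' - 1) by ring]
      refine le_trans ?_ (le_abs_self _)
      apply mul_le_mul_of_nonneg_left _ hδ
      nlinarith
    have e5 := tent_iterate_dist_step (by linarith) hbb (hs 4 ⟨by norm_num, by norm_num⟩)
    refine le_trans ?_ e5
    have hpos : 0 ≤ (tent b)^[4] 0 := by
      rw [h4, show 1 - b - b ^ 2 + b ^ 3 = (1 - b) ^ 2 * (1 + b) by ring]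
      positivity
    rw [abs_of_nonneg hpos]
    have hA2 : 1 / (b - 1) ≤ 2.4143 + 1 / 1000 := by
      rw [div_le_iff₀ (by linarith)]
      linarith
    have e6 : b * ((b' - b) * (3 * b ^ 2 - 2 * b - 1)) ≤
        b' * |(tent b')^[4] 0 - (tent b)^[4] 0| := by
      apply mul_le_mul hbb e4 _ (by linarith)
      apply mul_nonneg hδ
      nlinarith
    rw [h4] at e6 ⊢
    refine le_trans ?_ (sub_le_sub_right e6 _)
    rw [show b * ((b' - b) * (3 * b ^ 2 - 2 * b - 1)) - (b' - b) * (1 - b - b ^ 2 + b ^ 3) =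
      (b' - b) * (2 * b ^ 3 - b ^ 2 - 1) by ring]
    apply mul_le_mul_of_nonneg_left _ hδ
    have : (2.62 : ℝ) ≤ 2 * b ^ 3 - b ^ 2 - 1 := by
      have hb' : (1.4142 : ℝ) ≤ b := by linarith
      nlinarith [mul_nonneg (sub_nonneg.2 hb') (sub_nonneg.2 hb'),
        mul_nonneg (mul_nonneg (sub_nonneg.2 hb') (sub_nonneg.2 hb')) (sub_nonneg.2 hb')]
    linarith

lemma tent_iterate_expansion {b b' : ℝ} (hb : √2 ≤ b) (hbb : b ≤ b') (hb' : b' ≤ 2) (n : ℕ)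
    (hs : ∀ k ∈ Icc 1 (n + 4), 0 < (tent b)^[k] 0 * (tent b')^[k] 0) :
    (b' - b) * (1 / (b' - 1) + √2 ^ n * (1 / 5)) ≤
      |(tent b')^[n + 5] 0 - (tent b)^[n + 5] 0| := by
  have hs2 : (1.4142 : ℝ) ≤ √2 := Real.le_sqrt_of_sq_le (by norm_num)
  induction n with
  | zero => simpa using tent_iterate_expansion_five hb hbb hb' hs
  | succ n ih =>
    have h1 := ih fun k hk => hs k ⟨hk.1, hk.2.trans (by omega)⟩
    have h2 := tent_iterate_expansion_step (by linarith) hbb hb'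
      (hs (n + 5) ⟨by omega, by omega⟩) h1
    rw [show n + 1 + 5 = n + 5 + 1 by ring]
    refine le_trans ?_ h2
    apply mul_le_mul_of_nonneg_left _ (by linarith)
    have : √2 ^ (n + 1) * (1 / 5) ≤ b' * (√2 ^ n * (1 / 5)) := by
      rw [pow_succ', mul_assoc]
      apply mul_le_mul_of_nonneg_right (hb.trans hbb)
      positivity
    linarith

lemma exists_tent_iterate_eq_zero {lo hi : ℝ} (hlo : √2 ≤ lo) (hhi : hi ≤ 2) (n : ℕ)
    (hgap : 10 < (hi - lo) * √2 ^ n) :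
    ∃ b ∈ Ioo lo hi, ∃ k, 1 ≤ k ∧ k ≤ n + 5 ∧ (tent b)^[k] 0 = 0 := by
  have hs2 : (1.4142 : ℝ) ≤ √2 := Real.le_sqrt_of_sq_le (by norm_num)
  by_contra hno
  push Not at hno
  have hpow : 0 < √2 ^ n := by positivity
  have hδ : 0 < hi - lo := by
    by_contra hn
    push Not at hn
    nlinarith
  have key : ∀ b ∈ Ioo lo hi, ∀ b' ∈ Ioo lo hi, b ≤ b' → (b' - b) * √2 ^ n ≤ 10 := by
    intro b hb b' hb' hbb
    have hsign : ∀ k ∈ Icc 1 (n + 4), 0 < (tent b)^[k] 0 * (tent b')^[k] 0 := by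
      intro k hk
      by_contra hn
      push Not at hn
      have hc := (continuous_tent_iterate k).continuousOn (s := Icc b b')
      have hz : (0 : ℝ) ∈ (fun c : ℝ => (tent c)^[k] 0) '' Icc b b' := by
        rcases mul_nonpos_iff.1 hn with ⟨h1, h2⟩ | ⟨h1, h2⟩
        · exact intermediate_value_Icc' hbb hc ⟨h2, h1⟩
        · exact intermediate_value_Icc hbb hc ⟨h1, h2⟩
      obtain ⟨c, hc1, hc2⟩ := hz
      exact hno c ⟨hb.1.trans_le hc1.1, hc1.2.trans_lt hb'.2⟩ k hk.1 (hk.2.trans (by omega)) hc2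
    have h1 := tent_iterate_expansion (hlo.trans hb.1.le) hbb (hb'.2.le.trans hhi) n hsign
    have i1 := abs_tent_iterate_le_one (b := b) ⟨by linarith [hb.1], by linarith [hb.2]⟩ (n + 5)
    have i2 := abs_tent_iterate_le_one (b := b') ⟨by linarith [hb'.1], by linarith [hb'.2]⟩ (n + 5)
    have h2 := (abs_sub ((tent b')^[n + 5] 0) ((tent b)^[n + 5] 0))
    have h3 : 0 ≤ (b' - b) * (1 / (b' - 1)) := by
      apply mul_nonneg (by linarith)
      apply one_div_nonneg.2
      linarith [hb'.1]
    nlinarith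
  set η := (hi - lo - 10 / √2 ^ n) / 4 with hη
  have hη0 : 0 < η := by
    have : 10 / √2 ^ n < hi - lo := by rwa [div_lt_iff₀ hpow]
    linarith
  have h10 : 0 < 10 / √2 ^ n := by positivity
  have h1 := key (lo + η) ⟨by linarith, by linarith⟩ (hi - η) ⟨by linarith, by linarith⟩
    (by linarith)
  rw [← le_div_iff₀ hpow] at h1
  linarith

/-- `0` is periodic under the tent map of slope `b`, with minimal period `q`. -/
def IsTentPeriod (b : ℝ) (q : ℕ) : Prop :=
  1 ≤ q ∧ (tent b)^[q] 0 = 0 ∧ ∀ j, 1 ≤ j → j < q → (tent b)^[j] 0 ≠ 0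

lemma exists_isTentPeriod {b : ℝ} {k : ℕ} (hk : 1 ≤ k) (h0 : (tent b)^[k] 0 = 0) :
    ∃ q ≤ k, IsTentPeriod b q := by
  classical
  have hex : ∃ q, 1 ≤ q ∧ (tent b)^[q] 0 = 0 := ⟨k, hk, h0⟩
  refine ⟨Nat.find hex, Nat.find_min' hex ⟨hk, h0⟩, (Nat.find_spec hex).1,
    (Nat.find_spec hex).2, fun j hj hjq hz => Nat.find_min hex hjq ⟨hj, hz⟩⟩

lemma tent_sq_renormalization {b y : ℝ} (hb : 1 < b) (hb2 : b ^ 2 ≤ 2) (hy : |y| ≤ 1) :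
    0 < tent b ((1 - b) * y) ∧ tent b (tent b ((1 - b) * y)) = (1 - b) * tent (b ^ 2) y := by
  have h1 : |(1 - b) * y| = (b - 1) * |y| := by
    rw [abs_mul, abs_of_neg (by linarith)]
    ring
  have h0 := abs_nonneg y
  have hpos : 0 < tent b ((1 - b) * y) := by
    simp only [tent, h1]
    nlinarith [mul_nonneg (mul_nonneg (by linarith : (0 : ℝ) ≤ b) (by linarith : (0 : ℝ) ≤ b - 1))
      (sub_nonneg.2 hy)]
  refine ⟨hpos, ?_⟩
  rw [tent, abs_of_pos hpos, tent, h1, tent]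
  ring

lemma tent_iterate_two_mul {b : ℝ} (hb : 1 < b) (hb2 : b ^ 2 ≤ 2) (k : ℕ) :
    (tent b)^[2 * k] 0 = (1 - b) * (tent (b ^ 2))^[k] 0 ∧ 0 < (tent b)^[2 * k + 1] 0 := by
  have hb1 : b ^ 2 ∈ Icc (1 : ℝ) 2 := ⟨by nlinarith, hb2⟩
  have main : (tent b)^[2 * k] 0 = (1 - b) * (tent (b ^ 2))^[k] 0 := by
    induction k with
    | zero => simp
    | succ k ih =>
      rw [show 2 * (k + 1) = 2 * k + 1 + 1 by ring, Function.iterate_succ_apply',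
        Function.iterate_succ_apply', ih, Function.iterate_succ_apply']
      exact (tent_sq_renormalization hb hb2 (abs_tent_iterate_le_one hb1 k)).2
  refine ⟨main, ?_⟩
  rw [Function.iterate_succ_apply', main]
  exact (tent_sq_renormalization hb hb2 (abs_tent_iterate_le_one hb1 k)).1

lemma IsTentPeriod.two_mul {b : ℝ} {q : ℕ} (hb : 1 < b) (hb2 : b ^ 2 ≤ 2)
    (hq : IsTentPeriod (b ^ 2) q) : IsTentPeriod b (2 * q) := by
  obtain ⟨h1, h2, h3⟩ := hq
  refine ⟨by omega, ?_, fun j hj hjq => ?_⟩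
  · rw [(tent_iterate_two_mul hb hb2 q).1, h2, mul_zero]
  · rcases Nat.even_or_odd' j with ⟨i, rfl | rfl⟩
    · rw [(tent_iterate_two_mul hb hb2 i).1]
      exact mul_ne_zero (by linarith) (h3 i (by omega) (by omega))
    · exact (tent_iterate_two_mul hb hb2 i).2.ne'

lemma exists_isTentPeriod_renormalized {b : ℝ} (hb : 1 < b) (hb2 : b ≤ 2) {q : ℕ}
    (hq : IsTentPeriod b q) (m : ℕ) :
    ∃ b' ∈ Ioc (1 : ℝ) 2, Real.log b' = Real.log b / 2 ^ m ∧ IsTentPeriod b' (2 ^ m * q) := by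
  induction m with
  | zero => exact ⟨b, ⟨hb, hb2⟩, by simp, by simpa using hq⟩
  | succ m ih =>
    obtain ⟨b', ⟨h1, h2⟩, h3, h4⟩ := ih
    have hsq : √b' ^ 2 = b' := Real.sq_sqrt (by linarith)
    have h5 : 1 < √b' := Real.lt_sqrt_of_sq_lt (by linarith)
    refine ⟨√b', ⟨h5, by nlinarith⟩, ?_, ?_⟩
    · rw [Real.log_sqrt (by linarith), h3, pow_succ]
      field_simp
    · rw [pow_succ', mul_assoc]
      exact IsTentPeriod.two_mul h5 (by rwa [hsq]) (by rwa [hsq])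

lemma exists_isTentPeriod_between (m n : ℕ) {s t : ℝ}
    (hs : Real.log 2 / 2 ^ (m + 1) ≤ s) (ht : t ≤ Real.log 2 / 2 ^ m)
    (hgap : 100 * (2 : ℝ) ^ (-(m : ℝ)) * (2 : ℝ) ^ (-(n : ℝ) / 2) < t - s) :
    ∃ b ∈ Ioc (1 : ℝ) 2, Real.log b ∈ Ioo s t ∧ ∃ q ≤ 2 ^ m * n, IsTentPeriod b q := by
  have hm : (0 : ℝ) < 2 ^ m := by positivity
  have hl2 := Real.log_two_lt_d9
  have hl2' := Real.log_two_gt_d9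
  have hpow : (2 : ℝ) ^ (-(n : ℝ) / 2) = (√2 ^ n)⁻¹ := by
    rw [neg_div, Real.rpow_neg (by norm_num), Real.sqrt_eq_rpow, ← Real.rpow_natCast,
      ← Real.rpow_mul (by norm_num)]
    congr 2
    ring
  rw [hpow, Real.rpow_neg (by norm_num), Real.rpow_natCast] at hgap
  have hsq : 0 < √2 ^ n := by positivity
  have hgap' : 100 < (2 ^ m * t - 2 ^ m * s) * √2 ^ n := by
    have := mul_lt_mul_of_pos_right hgap (mul_pos hm hsq)
    field_simp at this
    linarith
  have hS : Real.log 2 / 2 ≤ 2 ^ m * s := by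
    rw [pow_succ, div_le_iff₀ (by positivity)] at hs
    linarith
  have hT : 2 ^ m * t ≤ Real.log 2 := by
    rwa [le_div_iff₀ hm, mul_comm] at ht
  set S := 2 ^ m * s
  set T := 2 ^ m * t
  have hs2 : √2 ^ 2 = 2 := Real.sq_sqrt (by norm_num)
  have hs2' : √2 ≤ 1.5 := by
    rw [Real.sqrt_le_left (by norm_num)]
    norm_num
  have hs1 : 1 ≤ √2 := Real.one_le_sqrt.2 (by norm_num)
  have hn : 5 ≤ n := by
    by_contra hn
    push Not at hn
    have : √2 ^ n ≤ √2 ^ 4 := pow_le_pow_right₀ hs1 (by omega)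
    nlinarith
  obtain ⟨k, rfl⟩ := Nat.exists_eq_add_of_le' hn
  have hexp : T - S ≤ Real.exp T - Real.exp S := by
    have h1 := Real.add_one_le_exp (T - S)
    have h2 : Real.exp T = Real.exp S * Real.exp (T - S) := by
      rw [← Real.exp_add]
      congr 1
      ring
    have h3 : 1 ≤ Real.exp S := Real.one_le_exp (by linarith)
    have h4 : 0 ≤ T - S := by
      by_contra hneg
      push Not at hneg
      nlinarith
    rw [h2]
    nlinarith
  have hlo : √2 ≤ Real.exp S := by
    rw [← Real.log_le_iff_le_exp (by linarith), Real.log_sqrt (by norm_num)]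
    exact hS
  have hhi : Real.exp T ≤ 2 := by
    rw [← Real.le_log_iff_exp_le (by norm_num)]
    exact hT
  obtain ⟨β, ⟨hβ1, hβ2⟩, j, hj1, hj2, hj3⟩ := exists_tent_iterate_eq_zero hlo hhi k (by
    have h5 : √2 ^ 5 ≤ 10 := by
      have : √2 ^ 5 = √2 ^ 2 * √2 ^ 2 * √2 := by ring
      rw [this, hs2]
      linarith
    rw [pow_add] at hgap'
    have hk : 0 < √2 ^ k := by positivity
    have h6 : (T - S) * (√2 ^ k * √2 ^ 5) ≤ (Real.exp T - Real.exp S) * (√2 ^ k * √2 ^ 5) :=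
      mul_le_mul_of_nonneg_right hexp (by positivity)
    have h7 : 0 < Real.exp T - Real.exp S := by
      by_contra hneg
      push Not at hneg
      have : (Real.exp T - Real.exp S) * (√2 ^ k * √2 ^ 5) ≤ 0 :=
        mul_nonpos_of_nonpos_of_nonneg hneg (by positivity)
      linarith
    have h8 : (Real.exp T - Real.exp S) * √2 ^ k * √2 ^ 5 ≤
        (Real.exp T - Real.exp S) * √2 ^ k * 10 :=
      mul_le_mul_of_nonneg_left h5 (by positivity)
    linarith)
  obtain ⟨q, hqj, hq⟩ := exists_isTentPeriod hj1 hj3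
  have hβ0 : 0 < β := (Real.exp_pos _).trans hβ1
  obtain ⟨b, hb, hlog, hper⟩ := exists_isTentPeriod_renormalized (b := β) (by
    have : (1 : ℝ) < √2 := Real.lt_sqrt_of_sq_lt (by norm_num)
    linarith) (by linarith) hq m
  refine ⟨b, hb, ?_, 2 ^ m * q, Nat.mul_le_mul_left _ (hqj.trans hj2), hper⟩
  rw [hlog]
  constructor
  · rw [lt_div_iff₀ hm, Real.lt_log_iff_exp_lt hβ0, mul_comm]
    exact hβ1
  · rw [div_lt_iff₀ hm, Real.log_lt_iff_lt_exp hβ0, mul_comm]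
    exact hβ2

open scoped Polynomial in
lemma finite_setOf_sum_div_sub_eq_zero {p : ℕ} {c A : ℕ → ℂ} (hp : 0 < p)
    (hinj : ∀ i < p, c i = c 0 → i = 0) (hA : A 0 ≠ 0) :
    {z : ℂ | ∑ i ∈ Finset.range p, A i / (z - c i) = 0}.Finite := by
  classical
  set Q : ℂ[X] := ∑ i ∈ Finset.range p, Polynomial.C (A i) *
    ∏ j ∈ (Finset.range p).erase i, (Polynomial.X - Polynomial.C (c j)) with hQ
  have hQ0 : Q ≠ 0 := by
    intro h0
    have h1 : Q.eval (c 0) = 0 := by rw [h0, Polynomial.eval_zero]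
    rw [hQ, Polynomial.eval_finsetSum, Finset.sum_eq_single 0] at h1
    · simp only [Polynomial.eval_mul, Polynomial.eval_C, Polynomial.eval_prod,
        Polynomial.eval_sub, Polynomial.eval_X, mul_eq_zero, hA, false_or,
        Finset.prod_eq_zero_iff, Finset.mem_erase, Finset.mem_range] at h1
      obtain ⟨j, ⟨hj0, hj⟩, hj2⟩ := h1
      exact hj0 (hinj j hj (sub_eq_zero.1 hj2).symm)
    · intro i hi hi0
      simp only [Polynomial.eval_mul, Polynomial.eval_prod]
      rw [Finset.prod_eq_zero (i := 0), mul_zero]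
      · simp [hp, hi0.symm]
      · simp
    · simp [hp.ne']
  refine ((Q.finite_setOfPred_isRoot hQ0).union
    (((Finset.range p).image c).finite_toSet)).subset fun z hz => ?_
  by_cases hzc : z ∈ ((Finset.range p).image c : Finset ℂ)
  · exact Or.inr hzc
  · left
    have hne : ∀ i ∈ Finset.range p, z - c i ≠ 0 := fun i hi h0 =>
      hzc (Finset.mem_image.2 ⟨i, hi, (sub_eq_zero.1 h0).symm⟩)
    have hz' : (∑ i ∈ Finset.range p, A i / (z - c i)) *
        ∏ j ∈ Finset.range p, (z - c j) = 0 := by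
      rw [mem_ofPred_eq] at hz
      rw [hz, zero_mul]
    rw [Finset.sum_mul] at hz'
    simp only [mem_ofPred_eq, Polynomial.IsRoot.def, hQ, Polynomial.eval_finsetSum]
    rw [← hz']
    refine Finset.sum_congr rfl fun i hi => ?_
    rw [← Finset.mul_prod_erase _ _ hi]
    simp only [Polynomial.eval_mul, Polynomial.eval_C, Polynomial.eval_prod,
        Polynomial.eval_sub, Polynomial.eval_X]
    have := hne i hi
    field_simp

lemma lintegral_ball_sum_div_sub_lt_top (p : ℕ) (c A : ℕ → ℂ) (R : ℝ) :
    ∫⁻ z in Metric.ball (0 : ℂ) R, ‖∑ i ∈ Finset.range p, A i / (z - c i)‖ₑ < ⊤ := by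
  have hinv : ∀ r : ℝ, IntegrableOn (fun z : ℂ => z⁻¹) (Metric.ball 0 r) := by
    intro r
    refine integrableOn_ball_of_norm_le_rpow (C := 1) (α := 1) ?_ ?_ ?_ ?_
    · simp
    · simp
    · refine Eventually.of_forall fun z => ?_
      rw [norm_inv, one_mul, Real.rpow_neg_one]
    · exact measurable_inv.aestronglyMeasurable
  have hsub : ∀ d : ℂ, IntegrableOn (fun z : ℂ => (z - d)⁻¹) (Metric.ball 0 R) := by
    intro d
    have h1 := ((measurePreserving_sub_right (volume : Measure ℂ) d).integrableOn_comp_preimage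
      (MeasurableEquiv.subRight d).measurableEmbedding).2 (hinv (R + ‖d‖))
    refine h1.mono_set fun z hz => ?_
    simp only [mem_preimage, mem_ball_zero_iff] at hz ⊢
    exact (norm_sub_le _ _).trans_lt (by linarith)
  have h2 : IntegrableOn (fun z : ℂ => ∑ i ∈ Finset.range p, A i / (z - c i))
      (Metric.ball 0 R) := by
    refine integrable_finsetSum _ fun i _ => ?_
    simp only [div_eq_mul_inv]
    exact (hsub (c i)).const_mul (A i)
  exact h2.2

lemma sq_add_functional_equation {p : ℕ} {c A : ℕ → ℂ} {ρ : ℂ}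
    (hc : ∀ i, c (i + 1) = c i ^ 2 + c 0) (hp0 : c p = 0)
    (hrec : ∀ i < p, A (i + 1) * (2 * c i) = ρ * A i)
    (hsum : ∑ i ∈ Finset.range (p + 1), A i = 0) {w : ℂ}
    (hw : ∀ i ≤ p, w ^ 2 + c 0 ≠ c i) (hw' : ∀ i ≤ p, w ^ 2 ≠ c i ^ 2) :
    4 * w ^ 2 * ∑ i ∈ Finset.range (p + 1), A i / (w ^ 2 + c 0 - c i) =
      ρ * (∑ i ∈ Finset.range (p + 1), A i / (w - c i) +
        ∑ i ∈ Finset.range (p + 1), A i / (-w - c i)) := by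
  have h1 : ∀ i ∈ Finset.range (p + 1), 4 * w ^ 2 * (A i / (w ^ 2 + c 0 - c i)) =
      4 * A i + 4 * (A i * (c i - c 0) / (w ^ 2 + c 0 - c i)) := by
    intro i hi
    have := sub_ne_zero.2 (hw i (Nat.lt_succ_iff.1 (Finset.mem_range.1 hi)))
    field_simp
    ring
  have h2 : ∀ i ∈ Finset.range (p + 1), A i / (w - c i) + A i / (-w - c i) =
      A i * (2 * c i) / (w ^ 2 - c i ^ 2) := by
    intro i hi
    have h3 := hw' i (Nat.lt_succ_iff.1 (Finset.mem_range.1 hi))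
    have h4 : w ^ 2 - c i ^ 2 ≠ 0 := sub_ne_zero.2 h3
    have h5 : w - c i ≠ 0 := by
      intro h0
      apply h4
      rw [show w ^ 2 - c i ^ 2 = (w - c i) * (w + c i) by ring, h0, zero_mul]
    have h6 : -w - c i ≠ 0 := by
      intro h0
      apply h4
      rw [show w ^ 2 - c i ^ 2 = -(w - c i) * (-w - c i) by ring, h0, mul_zero]
    rw [div_add_div _ _ h5 h6, div_eq_div_iff (mul_ne_zero h5 h6) h4]
    ring
  rw [Finset.mul_sum, Finset.sum_congr rfl h1, Finset.sum_add_distrib, ← Finset.mul_sum, hsum,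
    mul_zero, zero_add, Finset.sum_range_succ', sub_self, mul_zero, zero_div, mul_zero, add_zero,
    ← Finset.sum_add_distrib, Finset.sum_congr rfl h2, Finset.sum_range_succ, hp0, mul_zero,
    mul_zero, zero_div, add_zero, Finset.mul_sum]
  refine Finset.sum_congr rfl fun i hi => ?_
  have hi' := Finset.mem_range.1 hi
  rw [hc i, show w ^ 2 + c 0 - (c i ^ 2 + c 0) = w ^ 2 - c i ^ 2 by ring, ← mul_div_assoc,
    ← mul_div_assoc]
  congr 1
  linear_combination (2 * c i) * hrec i hi'

lemma volume_setOf_im_eq_zero : volume {z : ℂ | z.im = 0} = 0 := by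
  have h1 : {z : ℂ | z.im = 0} = (LinearMap.ker Complex.imLm : Submodule ℝ ℂ) := by
    ext z
    simp
  rw [h1]
  refine Measure.addHaar_submodule _ _ fun htop => ?_
  have h2 : Complex.I ∈ LinearMap.ker Complex.imLm := by
    rw [htop]
    trivial
  simp at h2

lemma det_smulRight_one_complex (d : ℂ) :
    ((ContinuousLinearMap.toSpanSingleton ℂ d : ℂ →L[ℂ] ℂ).restrictScalars ℝ).det =
      ‖d‖ ^ 2 := by
  have h1 := Algebra.norm_complex_apply d
  rw [Algebra.norm_apply, Complex.normSq_eq_norm_sq] at h1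
  rw [← h1, ContinuousLinearMap.det]
  congr 1
  ext
  simp [mul_comm]

/-- The pushforward of an area density under `w ↦ w ^ 2 + c`, estimated on a disk. -/
lemma lintegral_ball_le_of_sq_add {g : ℂ → ENNReal} (hg : Measurable g) {c : ℂ} (hc : c.im = 0)
    {R : ℝ}
    (hfe : ∀ᵐ w : ℂ, ENNReal.ofReal (‖2 * w‖ ^ 2) * g (w ^ 2 + c) ≤ g w + g (-w)) :
    ∫⁻ z in Metric.ball (0 : ℂ) R, g z ≤ ∫⁻ w in {w : ℂ | ‖w ^ 2 + c‖ < R}, g w := by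
  set V : Set ℂ := {w : ℂ | ‖w ^ 2 + c‖ < R} with hV
  have hVm : MeasurableSet V := (isOpen_lt (by fun_prop) (by fun_prop)).measurableSet
  set S : Set ℂ := {w : ℂ | 0 < w.re} ∩ V with hS
  have hSm : MeasurableSet S :=
    (isOpen_lt continuous_const Complex.continuous_re).measurableSet.inter hVm
  set f : ℂ → ℂ := fun w => w ^ 2 + c with hf
  have hder : ∀ w ∈ S, HasFDerivWithinAt f
      ((ContinuousLinearMap.toSpanSingleton ℂ (2 * w) : ℂ →L[ℂ] ℂ).restrictScalars ℝ) S w := by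
    intro w _
    have h1 : HasDerivAt f (2 * w) w := by
      have h2 := (hasDerivAt_pow 2 w).add_const c
      rw [show 2 * w = ((2 : ℕ) : ℂ) * w ^ (2 - 1) by norm_num]
      exact h2
    exact (h1.hasFDerivAt.restrictScalars ℝ).hasFDerivWithinAt
  have hinj : InjOn f S := by
    intro w hw v hv hwv
    have h1 : w ^ 2 = v ^ 2 := add_right_cancel hwv
    rcases sq_eq_sq_iff_eq_or_eq_neg.1 h1 with h2 | h2
    · exact h2
    · have h3 : 0 < w.re := hw.1
      have h4 : 0 < v.re := hv.1
      rw [h2, Complex.neg_re] at h3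
      linarith
  have hsub : Metric.ball (0 : ℂ) R ⊆ f '' S ∪ {z : ℂ | z.im = 0} := by
    intro z hz
    by_cases him : z.im = 0
    · exact Or.inr him
    left
    obtain ⟨w, hw⟩ := IsAlgClosed.exists_pow_nat_eq (z - c) two_pos
    have hw2 : w ^ 2 + c = z := by rw [hw]; ring
    have hre : w.re ≠ 0 := by
      intro h0
      apply him
      rw [← hw2, Complex.add_im, hc, sq, Complex.mul_im, h0]
      ring
    have hzR : ‖z‖ < R := by simpa using hz
    rcases lt_or_gt_of_ne hre with h1 | h1
    · refine ⟨-w, ⟨by simpa using h1, ?_⟩, ?_⟩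
      · simpa [hV, hw2] using hzR
      · simpa [hf] using hw2
    · refine ⟨w, ⟨h1, ?_⟩, hw2⟩
      simpa [hV, hw2] using hzR
  have hneg : ∫⁻ w in S, g (-w) = ∫⁻ w in -S, g w := by
    have h1 := ((Measure.measurePreserving_neg (volume : Measure ℂ)).setLIntegral_comp_preimage
      hSm.neg hg)
    rw [← h1]
    simp
  have hdisj : Disjoint S (-S) := by
    rw [Set.disjoint_left]
    rintro w hw hw'
    have h3 : 0 < w.re := hw.1
    have h4 : 0 < (-w).re := hw'.1
    rw [Complex.neg_re] at h4
    linarith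
  calc ∫⁻ z in Metric.ball (0 : ℂ) R, g z
      ≤ ∫⁻ z in f '' S ∪ {z : ℂ | z.im = 0}, g z := lintegral_mono_set hsub
    _ ≤ (∫⁻ z in f '' S, g z) + ∫⁻ z in {z : ℂ | z.im = 0}, g z := lintegral_union_le _ _ _
    _ = ∫⁻ z in f '' S, g z := by
        rw [setLIntegral_measure_zero _ _ volume_setOf_im_eq_zero, add_zero]
    _ = ∫⁻ w in S, ENNReal.ofReal (‖2 * w‖ ^ 2) * g (w ^ 2 + c) := by
        rw [lintegral_image_eq_lintegral_abs_det_fderiv_mul volume hSm hder hinj]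
        refine lintegral_congr fun w => ?_
        rw [det_smulRight_one_complex, abs_of_nonneg (by positivity)]
    _ ≤ ∫⁻ w in S, (g w + g (-w)) := lintegral_mono_ae (ae_restrict_of_ae hfe)
    _ = (∫⁻ w in S, g w) + ∫⁻ w in -S, g w := by rw [lintegral_add_left hg, hneg]
    _ = ∫⁻ w in S ∪ -S, g w := (lintegral_union hSm.neg hdisj).symm
    _ ≤ ∫⁻ w in V, g w := by
        refine lintegral_mono_set ?_
        rintro w (hw | hw)
        · exact hw.2
        · have h5 := hw.2
          simpa [hV] using h5

/-- Thurston-type rigidity: a quadratic polynomial with a periodic critical orbit admits no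
nonzero fixed integrable quadratic differential supported on that orbit. -/
lemma sum_ne_zero_of_superattracting {p : ℕ} {c A : ℕ → ℂ} {ρ : ℂ} (hρ : ‖ρ‖ ≤ 1)
    (hre : (c 0).im = 0)
    (hc : ∀ i, c (i + 1) = c i ^ 2 + c 0) (hp0 : c p = 0)
    (hinj : ∀ i < p + 1, c i = c 0 → i = 0) (hA : A 0 ≠ 0)
    (hrec : ∀ i < p, A (i + 1) * (2 * c i) = ρ * A i) :
    ∑ i ∈ Finset.range (p + 1), A i ≠ 0 := by
  intro hsum
  set φ : ℂ → ℂ := fun z => ∑ i ∈ Finset.range (p + 1), A i / (z - c i) with hφ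
  have hφm : Measurable φ := by
    refine Finset.measurable_sum _ fun i _ => ?_
    exact measurable_const.div (measurable_id.sub_const _)
  set g : ℂ → ENNReal := fun z => ‖φ z‖ₑ with hg
  have hgm : Measurable g := hφm.enorm
  have hbad : ∀ d : ℂ, ∀ᵐ w : ℂ, w ^ 2 ≠ d := by
    intro d
    have h1 : {w : ℂ | w ^ 2 = d}.Finite := by
      refine ((Polynomial.X ^ 2 - Polynomial.C d : Polynomial ℂ).finite_setOfPred_isRoot
        (Polynomial.X_pow_sub_C_ne_zero two_pos d)).subset fun w hw => ?_
      have hw' : w ^ 2 = d := hw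
      simp [Polynomial.IsRoot, hw']
    exact measure_eq_zero_iff_ae_notMem.1 (h1.measure_zero volume)
  have hfe : ∀ᵐ w : ℂ, ENNReal.ofReal (‖2 * w‖ ^ 2) * g (w ^ 2 + c 0) ≤ g w + g (-w) := by
    have h1 : ∀ᵐ w : ℂ, ∀ i : ℕ, w ^ 2 ≠ c i - c 0 := ae_all_iff.2 fun i => hbad _
    have h2 : ∀ᵐ w : ℂ, ∀ i : ℕ, w ^ 2 ≠ c i ^ 2 := ae_all_iff.2 fun i => hbad _
    filter_upwards [h1, h2] with w hw1 hw2
    have h3 := sq_add_functional_equation (w := w) hc hp0 hrec hsum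
      (fun i _ h0 => hw1 i (by rw [← h0]; ring)) (fun i _ => hw2 i)
    have h4 : ‖4 * w ^ 2 * φ (w ^ 2 + c 0)‖ₑ = ‖ρ * (φ w + φ (-w))‖ₑ := congrArg _ h3
    have h5 : ENNReal.ofReal (‖2 * w‖ ^ 2) = ‖4 * w ^ 2‖ₑ := by
      rw [← ofReal_norm]
      congr 1
      simp
      ring
    have h6 : ‖ρ‖ₑ ≤ 1 := by
      rw [← ofReal_norm]
      exact ENNReal.ofReal_le_one.2 hρ
    simp only [hg]
    rw [h5, ← enorm_mul, h4, enorm_mul]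
    calc ‖ρ‖ₑ * ‖φ w + φ (-w)‖ₑ ≤ 1 * ‖φ w + φ (-w)‖ₑ := mul_le_mul_left h6 _
      _ ≤ ‖φ w‖ₑ + ‖φ (-w)‖ₑ := by
        rw [one_mul]
        exact enorm_add_le _ _
  set R : ℝ := 2 + ‖c 0‖ with hR
  have hc0 : 0 ≤ ‖c 0‖ := norm_nonneg _
  have hmain := lintegral_ball_le_of_sq_add hgm hre (R := R) hfe
  set V : Set ℂ := {w : ℂ | ‖w ^ 2 + c 0‖ < R} with hV
  set E : Set ℂ := {w : ℂ | R + ‖c 0‖ < ‖w‖ ^ 2} ∩ Metric.ball 0 R with hE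
  have hEo : IsOpen E := (isOpen_lt (by fun_prop) (by fun_prop)).inter Metric.isOpen_ball
  have hVo : IsOpen V := isOpen_lt (by fun_prop) (by fun_prop)
  have hlow : ∀ w : ℂ, ‖w‖ ^ 2 - ‖c 0‖ ≤ ‖w ^ 2 + c 0‖ := by
    intro w
    have := norm_sub_le (w ^ 2 + c 0) (c 0)
    rw [add_sub_cancel_right, norm_pow] at this
    linarith
  have hVD : V ⊆ Metric.ball 0 R := by
    intro w hw
    have h1 : ‖w ^ 2 + c 0‖ < R := hw
    have h2 := hlow w
    rw [mem_ball_zero_iff]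
    by_contra hn
    push Not at hn
    have h3 : R * R ≤ ‖w‖ ^ 2 := by
      rw [sq]
      exact mul_self_le_mul_self (by linarith) hn
    nlinarith
  have hdisj : Disjoint V E := by
    rw [Set.disjoint_left]
    intro w hw hw'
    have h1 : ‖w ^ 2 + c 0‖ < R := hw
    have h2 := hlow w
    have h3 : R + ‖c 0‖ < ‖w‖ ^ 2 := hw'.1
    linarith
  have hEne : E.Nonempty := by
    have hlt : R + ‖c 0‖ < R ^ 2 := by nlinarith
    set t := √((R + ‖c 0‖ + R ^ 2) / 2) with ht
    have ht2 : t ^ 2 = (R + ‖c 0‖ + R ^ 2) / 2 := Real.sq_sqrt (by nlinarith)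
    have ht0 : 0 ≤ t := Real.sqrt_nonneg _
    refine ⟨(t : ℂ), ?_, ?_⟩
    · rw [mem_ofPred_eq, Complex.norm_real, Real.norm_eq_abs, sq_abs, ht2]
      linarith
    · rw [mem_ball_zero_iff, Complex.norm_real, Real.norm_eq_abs, abs_of_nonneg ht0]
      exact lt_of_pow_lt_pow_left₀ 2 (by linarith) (by rw [ht2]; linarith)
  have hadd : (∫⁻ w in V, g w) + ∫⁻ w in E, g w ≤ ∫⁻ w in V, g w := by
    rw [← lintegral_union hEo.measurableSet hdisj]
    exact (lintegral_mono_set (union_subset hVD inter_subset_right)).trans hmain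
  have hfin : ∫⁻ w in V, g w ≠ ⊤ :=
    ((lintegral_mono_set hVD).trans_lt (lintegral_ball_sum_div_sub_lt_top _ _ _ _)).ne
  have hE0 : ∫⁻ w in E, g w = 0 := by
    by_contra hne
    exact absurd hadd (not_le.2 (ENNReal.lt_add_right hfin hne))
  rw [setLIntegral_eq_zero_iff hEo.measurableSet hgm] at hE0
  have hfinite := finite_setOf_sum_div_sub_eq_zero (c := c) (A := A) p.succ_pos hinj hA
  have hnz := measure_eq_zero_iff_ae_notMem.1 (hfinite.measure_zero (volume : Measure ℂ))
  have hEae : ∀ᵐ w : ℂ, w ∉ E := by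
    filter_upwards [hE0, hnz] with w h1 h2 h3
    exact h2 (enorm_eq_zero.1 (h1 h3))
  exact (hEo.measure_pos volume hEne).ne' (measure_eq_zero_iff_ae_notMem.2 hEae)

lemma iterate_fa_succ (a x : ℝ) (i : ℕ) : (fa a)^[i + 1] x = ((fa a)^[i] x) ^ 2 + a := by
  rw [Function.iterate_succ_apply']
  rfl

lemma hasDerivAt_iterate_fa_self {a : ℝ} (p : ℕ)
    (hne : ∀ i < p, (fa a)^[i] a ≠ 0) :
    HasDerivAt (fun x => (fa x)^[p] x)
      ((∏ j ∈ Finset.range p, 2 * (fa a)^[j] a) *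
        ∑ i ∈ Finset.range (p + 1), (∏ j ∈ Finset.range i, 2 * (fa a)^[j] a)⁻¹) a := by
  induction p with
  | zero => simpa using hasDerivAt_id' a
  | succ p ih =>
    have h1 := ih fun i hi => hne i (by omega)
    have h2 := (h1.pow 2).add (hasDerivAt_id a)
    have hP : ∏ j ∈ Finset.range (p + 1), 2 * (fa a)^[j] a ≠ 0 :=
      Finset.prod_ne_zero_iff.2 fun j hj =>
        mul_ne_zero two_ne_zero (hne j (Finset.mem_range.1 hj))
    have hfun : (fun x => (fa x)^[p + 1] x) = (fun x => (fa x)^[p] x) ^ 2 + id := by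
      funext x
      rw [iterate_fa_succ]
      rfl
    rw [hfun, Finset.sum_range_succ _ (p + 1), mul_add, mul_inv_cancel₀ hP,
      Finset.prod_range_succ]
    refine HasDerivAt.congr_deriv h2 ?_
    norm_num
    ring

lemma sum_inv_prod_pos_of_superattracting {a : ℝ} {p : ℕ} (hp : (fa a)^[p] a = 0)
    (hne : ∀ i < p, (fa a)^[i] a ≠ 0) :
    0 < ∑ i ∈ Finset.range (p + 1), (∏ j ∈ Finset.range i, 2 * (fa a)^[j] a)⁻¹ := by
  set c : ℕ → ℝ := fun i => (fa a)^[i] a with hc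
  set L : ℕ → ℝ := fun i => ∏ j ∈ Finset.range i, 2 * c j with hL
  set D : ℝ → ℝ := fun ρ => ∑ i ∈ Finset.range (p + 1), ρ ^ i * (L i)⁻¹ with hD
  have hD0 : D 0 = 1 := by
    simp only [hD]
    rw [Finset.sum_range_succ', Finset.sum_eq_zero]
    · simp [hL]
    · intro i _
      simp
  have hinj : ∀ i < p + 1, c i = c 0 → i = 0 := by
    intro i hi h0
    by_contra hi0
    apply hne (p - i) (by omega)
    have h1 : (fa a)^[p - i] (c i) = (fa a)^[p - i] (c 0) := by rw [h0]
    simp only [hc, Function.iterate_zero, id] at h1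
    rw [← Function.iterate_add_apply, Nat.sub_add_cancel (by omega), hp] at h1
    exact h1.symm
  have hDne : ∀ ρ ∈ Icc (0 : ℝ) 1, D ρ ≠ 0 := by
    intro ρ hρ
    have h1 := sum_ne_zero_of_superattracting (p := p) (c := fun i => (c i : ℂ))
      (A := fun i => ((ρ ^ i * (L i)⁻¹ : ℝ) : ℂ)) (ρ := (ρ : ℂ))
      (by rw [Complex.norm_real, Real.norm_eq_abs, abs_of_nonneg hρ.1]; exact hρ.2)
      (by simp)
      (by
        intro i
        simp only [hc]
        rw [iterate_fa_succ]
        simp)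
      (by simp [hc, hp])
      (by
        intro i hi h0
        exact hinj i hi (by exact_mod_cast h0))
      (by simp [hL])
      (by
        intro i hi
        have h2 : c i ≠ 0 := hne i hi
        rw [← Complex.ofReal_ofNat, ← Complex.ofReal_mul, ← Complex.ofReal_mul,
          ← Complex.ofReal_mul]
        congr 1
        simp only [hL]
        rw [Finset.prod_range_succ, mul_inv, pow_succ]
        field_simp)
    intro h2
    apply h1
    rw [← Complex.ofReal_sum]
    exact_mod_cast h2
  have hcont : Continuous D := by
    simp only [hD]
    fun_prop
  have hD1 : D 1 = ∑ i ∈ Finset.range (p + 1), (L i)⁻¹ := by simp [hD]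
  change 0 < ∑ i ∈ Finset.range (p + 1), (L i)⁻¹
  rw [← hD1]
  by_contra hn
  push Not at hn
  obtain ⟨ρ, hρ, h0⟩ := intermediate_value_Icc' zero_le_one hcont.continuousOn
    (show (0 : ℝ) ∈ Icc (D 1) (D 0) from ⟨hn, by rw [hD0]; exact zero_le_one⟩)
  exact hDne ρ hρ h0

/-- Transversality: the critical orbit crosses zero with a definite orientation. -/
lemma eventually_prod_mul_iterate_fa_self_pos {a : ℝ} {p : ℕ} (hp : (fa a)^[p] a = 0)
    (hne : ∀ i < p, (fa a)^[i] a ≠ 0) :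
    ∀ᶠ x in nhdsWithin a (Ioi a), 0 < (∏ j ∈ Finset.range p, (fa a)^[j] a) * (fa x)^[p] x := by
  have h1 := hasDerivAt_iterate_fa_self p hne
  set P := ∏ j ∈ Finset.range p, (fa a)^[j] a with hP
  set S := ∑ i ∈ Finset.range (p + 1), (∏ j ∈ Finset.range i, 2 * (fa a)^[j] a)⁻¹
  have hS : 0 < S := sum_inv_prod_pos_of_superattracting hp hne
  have hP0 : P ≠ 0 := Finset.prod_ne_zero_iff.2 fun j hj => hne j (Finset.mem_range.1 hj)
  rw [Finset.prod_mul_distrib, ← hP] at h1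
  have h2 := h1.const_mul P
  have hpos : 0 < P * ((∏ j ∈ Finset.range p, (2 : ℝ)) * P * S) := by
    rw [Finset.prod_const, Finset.card_range,
      show P * (2 ^ p * P * S) = 2 ^ p * S * P ^ 2 by ring]
    positivity
  have h3 := (hasDerivAt_iff_tendsto_slope.1 h2).eventually (lt_mem_nhds hpos)
  have h4 := h3.filter_mono (nhdsWithin_mono a (fun x (hx : a < x) => ne_of_gt hx))
  filter_upwards [h4, self_mem_nhdsWithin] with x hx hxa
  have hxa' : a < x := hxa
  rw [slope_def_field] at hx
  simp only [hp, mul_zero, sub_zero] at hx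
  exact (div_pos_iff_of_pos_right (sub_pos.2 hxa')).1 hx

/-- The point `x` has itinerary with signs `w 0, …, w (n - 1)` under `f_a`. -/
def HasSigns (a : ℝ) (n : ℕ) (w : ℕ → ℝ) (x : ℝ) : Prop :=
  ∀ i < n, 0 < w i * (fa a)^[i] x

lemma continuous_iterate_fa (i : ℕ) : Continuous fun q : ℝ × ℝ => (fa q.1)^[i] q.2 := by
  induction i with
  | zero => exact continuous_snd
  | succ i ih =>
    simp only [iterate_fa_succ]
    fun_prop

lemma isOpen_setOf_hasSigns (n : ℕ) (w : ℕ → ℝ) :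
    IsOpen {q : ℝ × ℝ | HasSigns q.1 n w q.2} := by
  have h1 : {q : ℝ × ℝ | HasSigns q.1 n w q.2} =
      ⋂ i ∈ Iio n, {q : ℝ × ℝ | 0 < w i * (fa q.1)^[i] q.2} := by
    ext q
    simp [HasSigns]
  rw [h1]
  exact (finite_Iio n).isOpen_biInter fun i _ =>
    isOpen_lt continuous_const (continuous_const.mul (continuous_iterate_fa i))

lemma prod_mul_iterate_sub_pos {a x y : ℝ} {n : ℕ} {w : ℕ → ℝ} (hxy : x < y)
    (hw : ∀ i < n, 0 < w i * ((fa a)^[i] y + (fa a)^[i] x)) :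
    0 < (∏ i ∈ Finset.range n, w i) * ((fa a)^[n] y - (fa a)^[n] x) := by
  induction n with
  | zero => simpa using hxy
  | succ n ih =>
    have h1 := ih fun i hi => hw i (by omega)
    have h2 := mul_pos h1 (hw n (by omega))
    rw [Finset.prod_range_succ, iterate_fa_succ, iterate_fa_succ]
    refine h2.trans_eq ?_
    ring

lemma HasSigns.of_between {a x y z : ℝ} {n : ℕ} {w : ℕ → ℝ} (hx : HasSigns a n w x)
    (hz : HasSigns a n w z) (hxy : x < y) (hyz : y < z) : HasSigns a n w y := by
  intro i
  induction i using Nat.strong_induction_on with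
  | _ i ih =>
    intro hi
    have h1 := prod_mul_iterate_sub_pos (w := w) (n := i) (a := a) hxy fun j hj => by
      rw [mul_add]
      exact add_pos (ih j hj (by omega)) (hx j (by omega))
    have h2 := prod_mul_iterate_sub_pos (w := w) (n := i) (a := a) hyz fun j hj => by
      rw [mul_add]
      exact add_pos (hz j (by omega)) (ih j hj (by omega))
    have h3 := hx i hi
    have h4 := hz i hi
    by_contra hn
    push Not at hn
    have h5 : 0 < w i * (fa a)^[i] x - w i * (fa a)^[i] y := by linarith
    have h6 : 0 < w i * (fa a)^[i] z - w i * (fa a)^[i] y := by linarith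
    have h7 := mul_pos h1 h2
    have h8 := mul_pos h5 h6
    have h9 := mul_pos h7 h8
    have : ∀ P W X Y Z : ℝ, P * (Y - X) * (P * (Z - Y)) * ((W * X - W * Y) * (W * Z - W * Y)) =
      - (P * (Y - X) * (W * (Z - Y))) ^ 2 := by
      intros
      ring
    rw [this] at h9
    nlinarith [sq_nonneg ((∏ i ∈ Finset.range i, w i) * ((fa a)^[i] y - (fa a)^[i] x) *
      (w i * ((fa a)^[i] z - (fa a)^[i] y)))]

lemma hasSigns_succ_iff {a x : ℝ} {n : ℕ} {w : ℕ → ℝ} :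
    HasSigns a (n + 1) w x ↔ 0 < w 0 * x ∧ HasSigns a n (fun i => w (i + 1)) (fa a x) := by
  constructor
  · intro hx
    exact ⟨hx 0 (by omega), fun i hi => hx (i + 1) (by omega)⟩
  · rintro ⟨h0, h1⟩ i hi
    cases i with
    | zero => exact h0
    | succ i => exact h1 i (by omega)

lemma exists_hasSigns_succ_iff {a : ℝ} {n : ℕ} {w : ℕ → ℝ} (hw : w 0 ≠ 0) :
    (∃ x, HasSigns a (n + 1) w x) ↔ ∃ y, a < y ∧ HasSigns a n (fun i => w (i + 1)) y := by
  constructor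
  · rintro ⟨x, hx⟩
    rw [hasSigns_succ_iff] at hx
    have h0 : x ≠ 0 := by
      rintro rfl
      simp at hx
    refine ⟨fa a x, ?_, hx.2⟩
    have : 0 < x ^ 2 := by positivity
    simp only [fa]
    linarith
  · rintro ⟨y, hay, hy⟩
    have h1 : 0 < √(y - a) := Real.sqrt_pos.2 (by linarith)
    have h2 : √(y - a) ^ 2 = y - a := Real.sq_sqrt (by linarith)
    rcases lt_or_gt_of_ne hw with h3 | h3
    · refine ⟨-√(y - a), hasSigns_succ_iff.2 ⟨by nlinarith, ?_⟩⟩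
      have h4 : fa a (-√(y - a)) = y := by
        simp only [fa]
        nlinarith
      rwa [h4]
    · refine ⟨√(y - a), hasSigns_succ_iff.2 ⟨by positivity, ?_⟩⟩
      have h4 : fa a (√(y - a)) = y := by
        simp only [fa]
        linarith
      rwa [h4]

/-- A sign word realized just to the right of a parameter, by a point beyond the critical value,
is realized by such a point at that parameter as well. -/
lemma exists_hasSigns_of_eventually {a y₀ : ℝ} {n : ℕ} {v : ℕ → ℝ} (hy₀ : HasSigns a n v y₀)
    (hev : ∀ᶠ x in nhdsWithin a (Ioi a), ∃ y, x < y ∧ HasSigns x n v y) :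
    ∃ y, a < y ∧ HasSigns a n v y := by
  by_contra hn
  push Not at hn
  have hna : ¬ HasSigns a n v a := by
    intro ha
    have h1 : ∀ᶠ y in nhds a, HasSigns a n v y :=
      ((isOpen_setOf_hasSigns n v).preimage
        (Continuous.prodMk_right a)).mem_nhds ha
    have h2 := (h1.filter_mono nhdsWithin_le_nhds).and (self_mem_nhdsWithin (s := Ioi a))
    obtain ⟨y, hy, hay⟩ := h2.exists
    exact hn y hay hy
  have hlt : y₀ < a := by
    rcases lt_trichotomy y₀ a with h1 | h1 | h1
    · exact h1
    · rw [h1] at hy₀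
      exact absurd hy₀ hna
    · exact absurd hy₀ (hn y₀ h1)
  have hy₀ev : ∀ᶠ x in nhds a, HasSigns x n v y₀ :=
    ((isOpen_setOf_hasSigns n v).preimage (Continuous.prodMk_left y₀)).mem_nhds hy₀
  have hself : ∀ᶠ x in nhdsWithin a (Ioi a), HasSigns x n v x := by
    filter_upwards [hev, hy₀ev.filter_mono nhdsWithin_le_nhds, self_mem_nhdsWithin]
      with x ⟨y, hxy, hy⟩ hx hax
    exact hx.of_between hy (hlt.trans hax) hxy
  have hweak : ∀ j < n, 0 ≤ v j * (fa a)^[j] a := by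
    intro j hj
    have hcont : Continuous fun x : ℝ => v j * (fa x)^[j] x :=
      continuous_const.mul ((continuous_iterate_fa j).comp (continuous_id.prodMk continuous_id))
    have h1 := (hcont.tendsto a).mono_left (nhdsWithin_le_nhds (s := Ioi a))
    exact ge_of_tendsto h1 (hself.mono fun x hx => (hx j hj).le)
  have hex : ∃ p, p < n ∧ (fa a)^[p] a = 0 := by
    by_contra hno
    push Not at hno
    apply hna
    intro j hj
    have hv : v j ≠ 0 := fun h0 => by
      have := hy₀ j hj
      simp [h0] at this
    exact lt_of_le_of_ne (hweak j hj) (mul_ne_zero hv (hno j hj)).symm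
  classical
  obtain ⟨hpn, hp0⟩ := Nat.find_spec hex
  have hmin := fun i (hi : i < Nat.find hex) => Nat.find_min hex hi
  set p := Nat.find hex
  have hne : ∀ i < p, (fa a)^[i] a ≠ 0 := fun i hi h0 => hmin i hi ⟨by omega, h0⟩
  have hpos : ∀ i < p, 0 < v i * (fa a)^[i] a := by
    intro i hi
    have hv : v i ≠ 0 := fun h0 => by
      have := hy₀ i (by omega)
      simp [h0] at this
    exact lt_of_le_of_ne (hweak i (by omega)) (mul_ne_zero hv (hne i hi)).symm
  obtain ⟨x, hx1, hx2⟩ := ((eventually_prod_mul_iterate_fa_self_pos hp0 hne).and hself).exists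
  have hx3 := hx2 p hpn
  have h1 : 0 < ∏ i ∈ Finset.range p, v i * (fa a)^[i] a :=
    Finset.prod_pos fun i hi => hpos i (Finset.mem_range.1 hi)
  rw [Finset.prod_mul_distrib] at h1
  have h2 := prod_mul_iterate_sub_pos (w := v) (n := p) (a := a) hlt fun j hj => by
    rw [mul_add]
    exact add_pos (hpos j hj) (hy₀ j (by omega))
  have h3 := hy₀ p hpn
  rw [hp0] at h2
  set P := ∏ i ∈ Finset.range p, v i
  set L := ∏ i ∈ Finset.range p, (fa a)^[i] a
  have h4 := mul_pos (mul_pos (mul_pos hx1 hx3) h1) (mul_pos h2 h3)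
  have : ∀ L F V P Y : ℝ, L * F * (V * F) * (P * L) * (P * (0 - Y) * (V * Y)) =
    - (L * F * V * P * Y) ^ 2 := by
    intros
    ring
  rw [this] at h4
  nlinarith [sq_nonneg (L * (fa x)^[p] x * v p * P * (fa a)^[p] y₀)]

/-- Fewer sign words are realized as the parameter increases. -/
lemma exists_hasSigns_of_lt (n : ℕ) : ∀ {w : ℕ → ℝ} {a b : ℝ}, b < a →
    (∃ x, HasSigns a n w x) → ∃ x, HasSigns b n w x := by
  induction n with
  | zero => exact fun _ _ => ⟨0, fun i hi => absurd hi (by omega)⟩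
  | succ n ih =>
    intro w a b hba hx
    have hw : w 0 ≠ 0 := by
      obtain ⟨x, hx⟩ := hx
      intro h0
      have := hx 0 (by omega)
      simp [h0] at this
    rw [exists_hasSigns_succ_iff hw] at hx ⊢
    set v : ℕ → ℝ := fun i => w (i + 1)
    set U : Set ℝ := {x | ∃ y, x < y ∧ HasSigns x n v y} with hU
    have hUo : IsOpen U := by
      have h1 : U = Prod.fst '' ({q : ℝ × ℝ | q.1 < q.2} ∩
          {q : ℝ × ℝ | HasSigns q.1 n v q.2}) := by
        ext x
        simp [hU]
      rw [h1]
      exact isOpenMap_fst _ ((isOpen_lt continuous_fst continuous_snd).inter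
        (isOpen_setOf_hasSigns n v))
    by_contra hb
    obtain ⟨s, ⟨⟨hbs, hsa⟩, hsU⟩, hs⟩ := (isCompact_Icc.inter_right hUo.isClosed_compl :
      IsCompact (Icc b a ∩ Uᶜ)).exists_isGreatest ⟨b, ⟨le_refl b, hba.le⟩, hb⟩
    have hsa' : s < a := lt_of_le_of_ne hsa fun h0 => hsU (h0 ▸ hx)
    obtain ⟨y, -, hy⟩ := hx
    obtain ⟨y₀, hy₀⟩ := ih hsa' ⟨y, hy⟩
    refine hsU (exists_hasSigns_of_eventually hy₀ ?_)
    filter_upwards [Ioo_mem_nhdsGT hsa'] with x hx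
    by_contra hxU
    exact absurd (hs ⟨⟨hbs.trans hx.1.le, hx.2.le⟩, hxU⟩) (not_le.2 hx.1)

lemma prod_mul_iterate_sub_nonneg {a x y : ℝ} {n : ℕ} {w : ℕ → ℝ} (hxy : x ≤ y)
    (hw : ∀ i < n, 0 ≤ w i * ((fa a)^[i] y + (fa a)^[i] x)) :
    0 ≤ (∏ i ∈ Finset.range n, w i) * ((fa a)^[n] y - (fa a)^[n] x) := by
  induction n with
  | zero => simpa using hxy
  | succ n ih =>
    have h1 := ih fun i hi => hw i (by omega)
    have h2 := mul_nonneg h1 (hw n (by omega))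
    rw [Finset.prod_range_succ, iterate_fa_succ, iterate_fa_succ]
    refine h2.trans_eq ?_
    ring

/-- The signs encoded by a binary word, padded by `1`. -/
noncomputable def wordSign {n : ℕ} (u : Fin n → Bool) (i : ℕ) : ℝ :=
  if hi : i < n then (if u ⟨i, hi⟩ then 1 else -1) else 1

lemma abs_wordSign {n : ℕ} (u : Fin n → Bool) (i : ℕ) : |wordSign u i| = 1 := by
  unfold wordSign
  split_ifs <;> simp

/-- The binary words of length `n` realized as strict itineraries of `f_a`. -/
def signWords (a : ℝ) (n : ℕ) : Set (Fin n → Bool) :=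
  {u | ∃ x, HasSigns a n (wordSign u) x}

lemma signWords_subset {a b : ℝ} (hab : a ≤ b) (n : ℕ) : signWords b n ⊆ signWords a n := by
  rcases hab.eq_or_lt with rfl | hlt
  · exact subset_rfl
  · exact fun u hu => exists_hasSigns_of_lt n hlt hu

lemma finite_iterate_fa_preimage (a : ℝ) (i : ℕ) {S : Set ℝ} (hS : S.Finite) :
    ((fa a)^[i] ⁻¹' S).Finite := by
  induction i generalizing S with
  | zero => simpa using hS
  | succ i ih =>
    rw [Function.iterate_succ', preimage_comp]
    refine ih (hS.preimage' fun d _ => ?_)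
    refine (Set.toFinite {√(d - a), -√(d - a)}).subset fun x hx => ?_
    have h1 : x ^ 2 + a = d := hx
    have h2 : √(d - a) = |x| := by
      rw [← h1, add_sub_cancel_right, Real.sqrt_sq_eq_abs]
    simp only [mem_insert_iff, mem_singleton_iff, h2]
    rcases abs_choice x with h3 | h3 <;> simp [h3]

lemma exists_mem_signWords_weak (a : ℝ) (n : ℕ) (x : ℝ) :
    ∃ u ∈ signWords a n, ∀ i < n, 0 ≤ wordSign u i * (fa a)^[i] x := by
  have h1 : ∀ i : ℕ, ∀ᶠ y in nhdsWithin x {x}ᶜ,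
      (fa a)^[i] y ≠ 0 ∧ 0 ≤ (fa a)^[i] x * (fa a)^[i] y := by
    intro i
    have hfin := finite_iterate_fa_preimage a i (finite_singleton (0 : ℝ))
    have h2 : ∀ᶠ y in nhdsWithin x {x}ᶜ, (fa a)^[i] y ≠ 0 := by
      have h3 : ((fa a)^[i] ⁻¹' {0} \ {x})ᶜ ∈ nhds x :=
        hfin.sdiff.isClosed.isOpen_compl.mem_nhds (by simp)
      filter_upwards [mem_nhdsWithin_of_mem_nhds h3, self_mem_nhdsWithin] with y hy hyx h0
      exact hy ⟨h0, hyx⟩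
    have h4 : ∀ᶠ y in nhds x, 0 ≤ (fa a)^[i] x * (fa a)^[i] y := by
      by_cases h0 : (fa a)^[i] x = 0
      · simp [h0]
      · have hcont : Continuous fun y : ℝ => (fa a)^[i] x * (fa a)^[i] y :=
          continuous_const.mul ((continuous_iterate_fa i).comp (Continuous.prodMk_right a))
        have h5 := (hcont.tendsto x).eventually (lt_mem_nhds (mul_self_pos.2 h0))
        exact h5.mono fun y hy => hy.le
    exact h2.and (h4.filter_mono nhdsWithin_le_nhds)
  have h2 : ∀ᶠ y in nhdsWithin x {x}ᶜ, ∀ i ∈ Finset.range n,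
      (fa a)^[i] y ≠ 0 ∧ 0 ≤ (fa a)^[i] x * (fa a)^[i] y :=
    (Filter.eventually_all_finset _).2 fun i _ => h1 i
  obtain ⟨y, hy⟩ := h2.exists
  refine ⟨fun i => decide (0 < (fa a)^[i] y), ⟨y, fun i hi => ?_⟩, fun i hi => ?_⟩
  · obtain ⟨h3, -⟩ := hy i (Finset.mem_range.2 hi)
    rcases lt_or_gt_of_ne h3 with h4 | h4
    · simp [wordSign, hi, h4.not_gt, h4]
    · simp [wordSign, hi, h4]
  · obtain ⟨h3, h5⟩ := hy i (Finset.mem_range.2 hi)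
    rcases lt_or_gt_of_ne h3 with h4 | h4
    · simp only [wordSign, hi, h4.not_gt, decide_false, dite_true]
      simp only [Bool.false_eq_true, if_false]
      nlinarith
    · simp only [wordSign, hi, h4, decide_true, dite_true, if_true, one_mul]
      nlinarith

lemma one_half_le_and_le_two_of_mem {a : ℝ} (ha : a ∈ Icc (-2 : ℝ) (1 / 4)) :
    ∃ β : ℝ, 1 / 2 ≤ β ∧ β ≤ 2 ∧ β ^ 2 + a = β ∧ Ia a = Icc (-β) β := by
  refine ⟨(1 + √(1 - 4 * a)) / 2, ?_, ?_, ?_, ?_⟩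
  · linarith [Real.sqrt_nonneg (1 - 4 * a)]
  · have : √(1 - 4 * a) ≤ 3 := Real.sqrt_le_iff.2 ⟨by norm_num, by linarith [ha.1]⟩
    linarith
  · have := Real.sq_sqrt (show 0 ≤ 1 - 4 * a by linarith [ha.2])
    nlinarith
  · rw [Ia]
    congr 1
    ring

lemma mapsTo_fa_Ia {a : ℝ} (ha : a ∈ Icc (-2 : ℝ) (1 / 4)) : MapsTo (fa a) (Ia a) (Ia a) := by
  obtain ⟨β, h1, h2, h3, h4⟩ := one_half_le_and_le_two_of_mem ha
  rw [h4]
  rintro x ⟨hx1, hx2⟩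
  simp only [fa]
  constructor <;> nlinarith

lemma abs_iterate_fa_le_two {a : ℝ} (ha : a ∈ Icc (-2 : ℝ) (1 / 4)) {x : ℝ} (hx : x ∈ Ia a)
    (i : ℕ) : |(fa a)^[i] x| ≤ 2 := by
  have h0 := (mapsTo_fa_Ia ha).iterate i hx
  obtain ⟨β, h1, h2, h3, h4⟩ := one_half_le_and_le_two_of_mem ha
  rw [h4] at h0
  exact abs_le.2 ⟨by linarith [h0.1], by linarith [h0.2]⟩

/-- The entourage of pairs at distance less than `ε`. -/
def distLT (ε : ℝ) : SetRel ℝ ℝ := {q | dist q.1 q.2 < ε}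

lemma coverMincard_le_card_of_key {X κ : Type*} [Nonempty X] {T : X → X} {F : Set X}
    {U : SetRel X X} {n : ℕ} (key : X → κ) (K : Finset κ) (hK : ∀ x ∈ F, key x ∈ K)
    (hkey : ∀ x ∈ F, ∀ y ∈ F, key x = key y → (x, y) ∈ Dynamics.dynEntourage T U n) :
    Dynamics.coverMincard T F U n ≤ K.card := by
  classical
  have hrep : ∀ k : κ, ∃ y : X, ∀ x ∈ F, key x = k → y ∈ F ∧ key y = k := by
    intro k
    by_cases hk : ∃ x ∈ F, key x = k
    · obtain ⟨y, hy⟩ := hk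
      exact ⟨y, fun _ _ _ => hy⟩
    · push Not at hk
      exact ⟨Classical.arbitrary X, fun x hx hxk => absurd hxk (hk x hx)⟩
  choose rep hrep using hrep
  have hcov : Dynamics.IsDynCoverOf T F U n (K.image rep : Finset X) := by
    intro x hx
    obtain ⟨h1, h2⟩ := hrep (key x) x hx rfl
    exact ⟨rep (key x), by simpa using ⟨key x, hK x hx, rfl⟩, hkey x hx _ h1 h2.symm⟩
  refine hcov.coverMincard_le_card.trans ?_
  exact_mod_cast Finset.card_image_le

lemma coverMincard_le_ncard_signWords_mul {a : ℝ} (ha : a ∈ Icc (-2 : ℝ) (1 / 4)) {M : ℕ}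
    (hM : 0 < M) (n : ℕ) :
    Dynamics.coverMincard (fa a) (Ia a) (distLT (1 / M)) n ≤
      ((signWords a n).ncard * (4 * n * M + 1) : ℕ) := by
  classical
  have hM' : (0 : ℝ) < M := by exact_mod_cast hM
  choose u hu hweak using exists_mem_signWords_weak a n
  set P : (Fin n → Bool) → ℕ → ℝ := fun v j => ∏ i ∈ Finset.range j, wordSign v i with hP
  have hPabs : ∀ v j, |P v j| = 1 := by
    intro v j
    simp only [hP, Finset.abs_prod, abs_wordSign, Finset.prod_const_one]
  set Φ : ℝ → ℝ := fun x => ∑ j ∈ Finset.range n, P (u x) j * (fa a)^[j] x with hΦ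
  have hΦabs : ∀ x ∈ Ia a, |Φ x| ≤ 2 * n := by
    intro x hx
    refine (Finset.abs_sum_le_sum_abs _ _).trans ?_
    refine (Finset.sum_le_card_nsmul _ _ 2 fun j _ => ?_).trans_eq ?_
    · rw [abs_mul, hPabs, one_mul]
      exact abs_iterate_fa_le_two ha hx j
    · simp [mul_comm]
  set W : Finset (Fin n → Bool) := (Set.toFinite (signWords a n)).toFinset with hW
  have hcard : (W ×ˢ Finset.Icc (-(2 * n * M : ℤ)) (2 * n * M)).card =
      (signWords a n).ncard * (4 * n * M + 1) := by
    rw [Finset.card_product, hW, ← Set.ncard_eq_toFinset_card, Int.card_Icc]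
    congr 1
    have : (2 * n * M + 1 - -(2 * n * M) : ℤ) = ((4 * n * M + 1 : ℕ) : ℤ) := by
      push_cast
      ring
    rw [this, Int.toNat_natCast]
  rw [← hcard]
  refine coverMincard_le_card_of_key (fun x => (u x, ⌊M * Φ x⌋)) _ (fun x hx => ?_) ?_
  · have h1 := abs_le.1 (hΦabs x hx)
    simp only [Finset.mem_product, hW, Finite.mem_toFinset, hu, Finset.mem_Icc, true_and]
    constructor
    · rw [Int.le_floor]
      push_cast
      nlinarith
    · rw [← Int.floor_intCast (R := ℝ) (2 * n * M)]
      refine Int.floor_le_floor ?_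
      push_cast
      nlinarith
  · have key : ∀ x ∈ Ia a, ∀ y ∈ Ia a, x ≤ y → u x = u y → ⌊M * Φ x⌋ = ⌊M * Φ y⌋ →
        ∀ j < n, |(fa a)^[j] y - (fa a)^[j] x| < 1 / M := by
      intro x hx y hy hxy huxy hfl j hj
      have h1 : ∀ i ≤ n, 0 ≤ P (u x) i * ((fa a)^[i] y - (fa a)^[i] x) := by
        intro i hi
        refine prod_mul_iterate_sub_nonneg hxy fun k hk => ?_
        rw [mul_add]
        have := hweak y k (by omega)
        rw [← huxy] at this
        exact add_nonneg this (hweak x k (by omega))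
      have h2 : Φ y - Φ x = ∑ i ∈ Finset.range n,
          P (u x) i * ((fa a)^[i] y - (fa a)^[i] x) := by
        simp only [hΦ, ← huxy]
        rw [← Finset.sum_sub_distrib]
        exact Finset.sum_congr rfl fun i _ => by ring
      have h3 := Finset.single_le_sum
        (f := fun i => P (u x) i * ((fa a)^[i] y - (fa a)^[i] x))
        (fun i hi => h1 i (Finset.mem_range.1 hi).le) (Finset.mem_range.2 hj)
      rw [← h2] at h3
      have h4 := Int.abs_sub_lt_one_of_floor_eq_floor hfl
      have h5 : |(fa a)^[j] y - (fa a)^[j] x| =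
          P (u x) j * ((fa a)^[j] y - (fa a)^[j] x) := by
        rw [← abs_of_nonneg (h1 j hj.le), abs_mul, hPabs, one_mul]
      rw [h5, lt_div_iff₀ hM']
      have h6 := abs_lt.1 h4
      nlinarith [h6.1]
    intro x hx y hy hxy
    obtain ⟨h1, h2⟩ := Prod.mk.inj hxy
    rw [Dynamics.mem_dynEntourage]
    intro j hj
    change dist _ _ < _
    rw [Real.dist_eq]
    rcases le_total x y with h3 | h3
    · rw [abs_sub_comm]
      exact key x hx y hy h3 h1 h2 j hj
    · exact key y hy x hx h3 h1.symm h2.symm j hj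

lemma Set.Finite.exists_pos_forall_dist_lt {Z : Set ℝ} (hZ : Z.Finite) :
    ∃ δ > 0, ∀ x ∈ Z, ∀ y ∈ Z, dist x y < δ → x = y := by
  by_cases hn : Z.Nontrivial
  · refine ⟨Z.infsep, (hZ.infsep_pos_iff_nontrivial).2 hn, fun x hx y hy hxy => ?_⟩
    by_contra hne
    exact absurd (infsep_le_dist_of_mem hx hy hne) (not_le.2 hxy)
  · exact ⟨1, one_pos, fun x hx y hy _ => (not_nontrivial_iff.1 hn) hx hy⟩

lemma exists_forall_iterate_mul_pos (a : ℝ) (k : ℕ) :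
    ∃ ε > 0, ∃ g : ℝ → ℝ, ∀ z x y, dist x z < ε → dist y z < ε →
      SignType.sign (x - g z) = SignType.sign (y - g z) →
      (∀ i < k, (fa a)^[i] x ≠ 0) → (∀ i < k, (fa a)^[i] y ≠ 0) →
      ∀ i < k, 0 < (fa a)^[i] x * (fa a)^[i] y := by
  classical
  set Z : Set ℝ := ⋃ i ∈ Iio k, (fa a)^[i] ⁻¹' {0} with hZ
  have hZf : Z.Finite :=
    (finite_Iio k).biUnion fun i _ => finite_iterate_fa_preimage a i (finite_singleton 0)
  obtain ⟨δ, hδ, hsep⟩ := hZf.exists_pos_forall_dist_lt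
  have hg : ∀ z : ℝ, ∃ c : ℝ, ∀ d ∈ Z, dist d z < δ / 2 → d = c := by
    intro z
    by_cases hc : ∃ c ∈ Z, dist c z < δ / 2
    · obtain ⟨c, hcZ, hcz⟩ := hc
      refine ⟨c, fun d hd hdz => hsep d hd c hcZ ?_⟩
      linarith [dist_triangle_right d c z]
    · push Not at hc
      exact ⟨z, fun d hd hdz => absurd hdz (not_lt.2 (hc d hd))⟩
  choose g hg using hg
  have key : ∀ z x y, x ≤ y → dist x z < δ / 2 → dist y z < δ / 2 →
      SignType.sign (x - g z) = SignType.sign (y - g z) →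
      (∀ i < k, (fa a)^[i] x ≠ 0) → (∀ i < k, (fa a)^[i] y ≠ 0) →
      ∀ i < k, 0 < (fa a)^[i] x * (fa a)^[i] y := by
    intro z x y hxy hxz hyz hsgn hx hy i hi
    by_contra hn
    push Not at hn
    have hcont : Continuous fun y : ℝ => (fa a)^[i] y :=
      (continuous_iterate_fa i).comp (Continuous.prodMk_right a)
    have h0 : (0 : ℝ) ∈ uIcc ((fa a)^[i] x) ((fa a)^[i] y) := by
      rw [mem_uIcc]
      rcases lt_or_gt_of_ne (hx i hi) with h1 | h1
      · left
        exact ⟨h1.le, by nlinarith⟩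
      · right
        exact ⟨by nlinarith, h1.le⟩
    obtain ⟨c, hc, hc0⟩ := intermediate_value_uIcc hcont.continuousOn h0
    rw [uIcc_of_le hxy] at hc
    have hcZ : c ∈ Z := mem_biUnion (mem_Iio.2 hi) hc0
    have hxc : x < c := lt_of_le_of_ne hc.1 fun h1 => hx i hi (h1 ▸ hc0)
    have hcy : c < y := lt_of_le_of_ne hc.2 fun h1 => hy i hi (h1 ▸ hc0)
    have hcz : dist c z < δ / 2 := by
      rw [Real.dist_eq, abs_lt] at *
      constructor <;> linarith
    rw [← hg z c hcZ hcz, sign_neg (sub_neg.2 hxc), sign_pos (sub_pos.2 hcy)] at hsgn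
    exact absurd hsgn (by decide)
  refine ⟨δ / 2, half_pos hδ, g, fun z x y hx hy hs hxs hys i hi => ?_⟩
  rcases le_total x y with h1 | h1
  · exact key z x y h1 hx hy hs hxs hys i hi
  · rw [mul_comm]
    exact key z y x h1 hy hx hs.symm hys hxs i hi

lemma exists_mem_Ia_hasSigns {a : ℝ} (ha : a ∈ Icc (-2 : ℝ) (1 / 4)) {n : ℕ} {w : ℕ → ℝ} {x : ℝ}
    (hx : HasSigns a n w x) : ∃ y ∈ Ia a, HasSigns a n w y := by
  obtain ⟨β, h1, h2, h3, h4⟩ := one_half_le_and_le_two_of_mem ha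
  by_cases hxI : x ∈ Ia a
  · exact ⟨x, hxI, hx⟩
  have hβx : β < |x| := by
    rw [h4] at hxI
    by_contra hn
    exact hxI (abs_le.1 (not_lt.1 hn))
  have hfar : ∀ i, β < (fa a)^[i + 1] x := by
    intro i
    induction i with
    | zero =>
      rw [iterate_fa_succ, Function.iterate_zero, id, ← sq_abs]
      nlinarith
    | succ i ih =>
      rw [iterate_fa_succ]
      nlinarith
  obtain ⟨y, hyβ, hxy⟩ : ∃ y, |y| = β ∧ 0 < x * y := by
    have hβ : 0 < β := by linarith
    rcases lt_or_gt_of_ne (show x ≠ 0 by rintro rfl; simp at hβx; linarith) with h5 | h5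
    · exact ⟨-β, by rw [abs_neg, abs_of_pos hβ], by nlinarith⟩
    · exact ⟨β, abs_of_pos hβ, by positivity⟩
  have hy : ∀ i, (fa a)^[i + 1] y = β := by
    intro i
    induction i with
    | zero => rw [iterate_fa_succ, Function.iterate_zero, id, ← sq_abs, hyβ, h3]
    | succ i ih => rw [iterate_fa_succ, ih, h3]
  refine ⟨y, by rw [h4]; exact abs_le.1 hyβ.le, fun i hi => ?_⟩
  have h6 := hx i hi
  cases i with
  | zero =>
    simp only [Function.iterate_zero, id] at h6 ⊢
    have := mul_pos h6 hxy
    by_contra hn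
    nlinarith [sq_nonneg x]
  | succ i =>
    have h7 := hfar i
    rw [hy i]
    have h8 : 0 < w (i + 1) := (pos_iff_pos_of_mul_pos h6).2 (by linarith)
    exact mul_pos h8 (by linarith)

lemma exists_ncard_signWords_le_card_mul {a : ℝ} (ha : a ∈ Icc (-2 : ℝ) (1 / 4)) {k : ℕ}
    (hk : 0 < k) :
    ∃ ε > 0, ∀ n : ℕ, ∀ s : Finset ℝ,
      Dynamics.IsDynCoverOf (fa a) (Ia a) (distLT ε) (k * n) s →
      (signWords a (k * n)).ncard ≤ s.card * 3 ^ n := by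
  classical
  obtain ⟨ε, hε, g, hg⟩ := exists_forall_iterate_mul_pos a k
  refine ⟨ε, hε, fun n s hs => ?_⟩
  have h1 : ∀ u : Fin (k * n) → Bool, ∃ q : ℝ × ℝ, u ∈ signWords a (k * n) →
      HasSigns a (k * n) (wordSign u) q.1 ∧ q.2 ∈ s ∧
        ∀ j < k * n, dist ((fa a)^[j] q.1) ((fa a)^[j] q.2) < ε := by
    intro u
    by_cases hu : u ∈ signWords a (k * n)
    · obtain ⟨x₀, hx₀⟩ := hu
      obtain ⟨x, hxI, hx⟩ := exists_mem_Ia_hasSigns ha hx₀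
      obtain ⟨y, hys, hxy⟩ := hs hxI
      exact ⟨(x, y), fun _ => ⟨hx, hys, Dynamics.mem_dynEntourage.1 hxy⟩⟩
    · exact ⟨0, fun h0 => absurd h0 hu⟩
  choose q hq using h1
  set code : (Fin (k * n) → Bool) → ℝ × (Fin n → SignType) := fun u =>
    ((q u).2, fun i => SignType.sign ((fa a)^[k * i] (q u).1 - g ((fa a)^[k * i] (q u).2)))
    with hcode
  have hcard : ((s ×ˢ (Finset.univ : Finset (Fin n → SignType)) :
      Finset (ℝ × (Fin n → SignType))) : Set (ℝ × (Fin n → SignType))).ncard =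
      s.card * 3 ^ n := by
    rw [Set.ncard_coe_finset, Finset.card_product, Finset.card_univ, Fintype.card_fun,
      Fintype.card_fin]
    rfl
  rw [← hcard]
  refine Set.ncard_le_ncard_of_injOn code (fun u hu => ?_) ?_ (Finset.finite_toSet _)
  · simpa [hcode] using (hq u hu).2.1
  · intro u hu v hv huv
    obtain ⟨hu1, -, hu3⟩ := hq u hu
    obtain ⟨hv1, -, hv3⟩ := hq v hv
    obtain ⟨hcen, hsgn⟩ := Prod.mk.inj huv
    funext ⟨j, hj⟩
    have hi : j / k < n := Nat.div_lt_of_lt_mul hj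
    have hr : j % k < k := Nat.mod_lt _ hk
    have hkj : k * (j / k) + j % k = j := Nat.div_add_mod j k
    have hblock : ∀ r < k, k * (j / k) + r < k * n := by
      intro r hr
      have : k * (j / k + 1) ≤ k * n := Nat.mul_le_mul_left k hi
      rw [mul_add, mul_one] at this
      omega
    have hnz : ∀ v : Fin (k * n) → Bool, ∀ x, HasSigns a (k * n) (wordSign v) x →
        ∀ r < k, (fa a)^[r] ((fa a)^[k * (j / k)] x) ≠ 0 := by
      intro v x hx r hr h0
      have h2 := hx _ (hblock r hr)
      rw [add_comm, Function.iterate_add_apply, h0, mul_zero] at h2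
      exact lt_irrefl _ h2
    have hlt : k * (j / k) < k * n := by simpa using hblock 0 hk
    have h2 := hg _ _ _ (hu3 _ hlt) (hcen ▸ hv3 _ hlt) (by
      have h3 := congrFun hsgn ⟨j / k, hi⟩
      rw [← hcen] at h3
      exact h3) (hnz u _ hu1) (hnz v _ hv1) _ hr
    rw [← Function.iterate_add_apply, ← Function.iterate_add_apply, add_comm, hkj] at h2
    have h4 := mul_pos (mul_pos (hu1 j hj) (hv1 j hj)) h2
    by_contra hne
    have h5 : wordSign u j * wordSign v j = -1 := by
      simp only [wordSign, hj, dite_true]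
      rcases Bool.eq_false_or_eq_true (u ⟨j, hj⟩) with h6 | h6 <;>
        rcases Bool.eq_false_or_eq_true (v ⟨j, hj⟩) with h7 | h7 <;>
        simp_all
    have : ∀ W V X Y : ℝ, W * X * (V * Y) * (X * Y) = W * V * (X * Y) ^ 2 := by
      intros
      ring
    rw [this, h5] at h4
    nlinarith [sq_nonneg ((fa a)^[j] (q u).1 * (fa a)^[j] (q v).1)]

lemma distLT_mem_uniformity {ε : ℝ} (hε : 0 < ε) : distLT ε ∈ uniformity ℝ :=
  Metric.dist_mem_uniformity hε

lemma linear_le_mul_two_pow (c n : ℕ) : c * n + 1 ≤ (c + 1) * 2 ^ n := by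
  have h1 : n + 1 ≤ 2 ^ n := Nat.lt_two_pow_self
  nlinarith

lemma coverEntropy_eq_iSup_distLT (T : ℝ → ℝ) (F : Set ℝ) :
    Dynamics.coverEntropy T F =
      ⨆ (M : ℕ) (_ : 0 < M), Dynamics.coverEntropyEntourage T F (distLT (1 / M)) :=
  Dynamics.coverEntropy_eq_iSup_basis Metric.uniformity_basis_dist_inv_nat_pos T F

lemma coverEntropy_fa_ne_top {a : ℝ} (ha : a ∈ Icc (-2 : ℝ) (1 / 4)) :
    Dynamics.coverEntropy (fa a) (Ia a) ≠ ⊤ := by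
  have h1 : Dynamics.coverEntropy (fa a) (Ia a) ≤ ENNReal.log 4 := by
    rw [coverEntropy_eq_iSup_distLT]
    refine iSup₂_le fun M hM => ?_
    rw [← ExpGrowth.expGrowthSup_pow]
    refine ExpGrowth.expGrowthSup_le_of_eventually_le (b := ((4 * M + 1 : ℕ) : ENNReal))
      (ENNReal.natCast_ne_top _) (Eventually.of_forall fun n => ?_)
    have h2 := coverMincard_le_ncard_signWords_mul ha hM n
    have h3 : (signWords a n).ncard ≤ 2 ^ n := by
      refine (Set.ncard_le_card _).trans ?_
      simp
    have h4 : (signWords a n).ncard * (4 * n * M + 1) ≤ (4 * M + 1) * 4 ^ n := by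
      have h5 := linear_le_mul_two_pow (4 * M) n
      calc (signWords a n).ncard * (4 * n * M + 1)
          ≤ 2 ^ n * ((4 * M + 1) * 2 ^ n) :=
            Nat.mul_le_mul h3 (by rw [mul_right_comm]; exact h5)
        _ = (4 * M + 1) * 4 ^ n := by
            rw [show (4 : ℕ) = 2 * 2 by norm_num, mul_pow]
            ring
    have h6 := ENat.toENNReal_mono (h2.trans (Nat.cast_le.2 h4))
    refine h6.trans_eq ?_
    push_cast
    simp
  refine ne_top_of_le_ne_top ?_ h1
  simp

lemma natCast_mul_coverEntropyEntourage_le {a b : ℝ} (ha : a ∈ Icc (-2 : ℝ) (1 / 4))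
    (hb : b ∈ Icc (-2 : ℝ) (1 / 4)) (hab : a ≤ b) {M k : ℕ} (hM : 0 < M) (hk : 0 < k) :
    k * Dynamics.coverEntropyEntourage (fa b) (Ia b) (distLT (1 / M)) ≤
      ENNReal.log 6 + k * Dynamics.coverEntropy (fa a) (Ia a) := by
  obtain ⟨ε, hε, hcount⟩ := exists_ncard_signWords_le_card_mul ha hk
  have hU := distLT_mem_uniformity hε
  have hcpt : IsCompact (Ia a) := isCompact_Icc
  have hmono : ∀ (T : ℝ → ℝ) (F : Set ℝ) (U : SetRel ℝ ℝ),
      Monotone fun n : ℕ => (Dynamics.coverMincard T F U n : ENNReal) :=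
    fun T F U _ _ hmn => ENat.toENNReal_mono (Dynamics.coverMincard_monotone_time T F U hmn)
  have hbound : ∀ n : ℕ,
      (Dynamics.coverMincard (fa b) (Ia b) (distLT (1 / M)) (k * n) : ENNReal) ≤
      ((4 * (k * M) + 1 : ℕ) : ENNReal) *
        (6 ^ n * Dynamics.coverMincard (fa a) (Ia a) (distLT ε) (k * n)) := by
    intro n
    obtain ⟨s, hs, hcard⟩ := (Dynamics.coverMincard_finite_iff _ _ _ _).1
      (Dynamics.coverMincard_finite_of_isCompact_invariant hcpt (mapsTo_fa_Ia ha) hU (k * n))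
    have h1 := hcount n s hs
    have h2 := coverMincard_le_ncard_signWords_mul hb hM (k * n)
    have h3 : (signWords b (k * n)).ncard ≤ s.card * 3 ^ n :=
      (Set.ncard_le_ncard (signWords_subset hab _) (Set.toFinite _)).trans h1
    have h4 : (signWords b (k * n)).ncard * (4 * (k * n) * M + 1) ≤
        (4 * (k * M) + 1) * (6 ^ n * s.card) := by
      have h5 := linear_le_mul_two_pow (4 * (k * M)) n
      calc (signWords b (k * n)).ncard * (4 * (k * n) * M + 1)
          ≤ (s.card * 3 ^ n) * ((4 * (k * M) + 1) * 2 ^ n) := by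
            refine Nat.mul_le_mul h3 ?_
            rw [show 4 * (k * n) * M = 4 * (k * M) * n by ring]
            exact h5
        _ = (4 * (k * M) + 1) * (6 ^ n * s.card) := by
            rw [show (6 : ℕ) = 3 * 2 by norm_num, mul_pow]
            ring
    have h6 := ENat.toENNReal_mono (h2.trans (Nat.cast_le.2 h4))
    refine h6.trans_eq ?_
    rw [← hcard]
    push_cast
    simp
  rw [Dynamics.coverEntropyEntourage, ← (hmono _ _ _).expGrowthSup_comp_mul hk.ne']
  refine (ExpGrowth.expGrowthSup_le_of_eventually_le (ENNReal.natCast_ne_top _)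
    (Eventually.of_forall hbound)).trans ?_
  refine (ExpGrowth.expGrowthSup_mul_le (u := fun n => 6 ^ n) ?_ ?_).trans ?_
  · left
    rw [ExpGrowth.expGrowthSup_pow]
    simp
  · left
    rw [ExpGrowth.expGrowthSup_pow]
    simp
  · rw [ExpGrowth.expGrowthSup_pow, (hmono _ _ _).expGrowthSup_comp_mul hk.ne']
    gcongr
    exact Dynamics.coverEntropyEntourage_le_coverEntropy _ _ hU

lemma coverEntropy_fa_antitone {a b : ℝ} (ha : a ∈ Icc (-2 : ℝ) (1 / 4))
    (hb : b ∈ Icc (-2 : ℝ) (1 / 4)) (hab : a ≤ b) :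
    Dynamics.coverEntropy (fa b) (Ia b) ≤ Dynamics.coverEntropy (fa a) (Ia a) := by
  rw [coverEntropy_eq_iSup_distLT (fa b)]
  refine iSup₂_le fun M hM => ?_
  have hle := fun (k : ℕ) (hk : 0 < k) => natCast_mul_coverEntropyEntourage_le ha hb hab hM hk
  have hne : (Ia a).Nonempty := by
    obtain ⟨β, h1, -, -, h4⟩ := one_half_le_and_le_two_of_mem ha
    exact ⟨0, by rw [h4]; constructor <;> linarith⟩
  have hA0 := Dynamics.coverEntropy_nonneg (fa a) hne
  have hAtop := coverEntropy_fa_ne_top ha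
  generalize Dynamics.coverEntropy (fa a) (Ia a) = A at *
  generalize Dynamics.coverEntropyEntourage (fa b) (Ia b) (distLT (1 / M)) = E at *
  obtain ⟨l, hl⟩ : ∃ l : ℝ, ENNReal.log 6 = (l : EReal) :=
    ⟨(ENNReal.log 6).toReal, (EReal.coe_toReal (by simp) (by simp)).symm⟩
  rw [hl] at hle
  lift A to ℝ using ⟨hAtop, ne_bot_of_le_ne_bot (by simp) hA0⟩
  induction E with
  | bot => exact bot_le
  | top =>
    have h1 := hle 1 one_pos
    rw [Nat.cast_one, one_mul, one_mul, ← EReal.coe_add] at h1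
    exact absurd h1 (not_le.2 (EReal.coe_lt_top _))
  | coe e =>
    rw [EReal.coe_le_coe_iff]
    by_contra hn
    push Not at hn
    obtain ⟨k, hk⟩ := exists_nat_gt (|l| / (e - A))
    rw [div_lt_iff₀ (sub_pos.2 hn)] at hk
    have hk0 : 0 < k := by
      rcases Nat.eq_zero_or_pos k with rfl | h1
      · rw [Nat.cast_zero, zero_mul] at hk
        exact absurd hk (not_lt.2 (abs_nonneg l))
      · exact h1
    have h1 := hle k hk0
    have h2 : (k : ℝ) * e ≤ l + k * A := by exact_mod_cast h1
    linarith [le_abs_self l]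

lemma h_antitoneOn : AntitoneOn h (Icc (-2 : ℝ) (1 / 4)) := by
  intro a ha b hb hab
  have hne : (Ia b).Nonempty := by
    obtain ⟨β, h1, -, -, h4⟩ := one_half_le_and_le_two_of_mem hb
    exact ⟨0, by rw [h4]; constructor <;> linarith⟩
  exact EReal.toReal_le_toReal (coverEntropy_fa_antitone ha hb hab)
    (ne_bot_of_le_ne_bot (by simp) (Dynamics.coverEntropy_nonneg (fa b) hne))
    (coverEntropy_fa_ne_top ha)

/-- Lemma (Guckenheimer-type): there is `C > 0` such that, for parameters `a ≤ a'` in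
`[-2, 1/4]` with entropies in `[2^{−m−1} log 2, 2^{−m} log 2]`, if
`|h(a) − h(a')| > C·2^{−m}·2^{−n/2}`, then there is a tent parameter `b̂` whose turning
point is periodic with minimal period at most `2^m·n` and with
`h⁻¹({log b̂}) ⊆ [a, a']`. -/
theorem periodic_tent_between_entropies :
    ∃ C : ℝ, 0 < C ∧ ∀ m n : ℕ, 1 ≤ n →
      ∀ a ∈ Set.Icc (-2 : ℝ) (1 / 4), ∀ a' ∈ Set.Icc (-2 : ℝ) (1 / 4), a ≤ a' →
      h a ∈ Set.Icc (Real.log 2 / 2 ^ (m + 1)) (Real.log 2 / 2 ^ m) →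
      h a' ∈ Set.Icc (Real.log 2 / 2 ^ (m + 1)) (Real.log 2 / 2 ^ m) →
      C * (2 : ℝ) ^ (-(m : ℝ)) * (2 : ℝ) ^ (-(n : ℝ) / 2) < |h a - h a'| →
      ∃ b ∈ Set.Ioc (1 : ℝ) 2, ∃ q : ℕ, 1 ≤ q ∧ q ≤ 2 ^ m * n ∧
        (tent b)^[q] 0 = 0 ∧ (∀ j, 1 ≤ j → j < q → (tent b)^[j] 0 ≠ 0) ∧
        {x ∈ Set.Icc (-2 : ℝ) (1 / 4) | h x = Real.log b} ⊆ Set.Icc a a' := by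
  refine ⟨100, by norm_num, fun m n _ a ha a' ha' haa' hha hha' hgap => ?_⟩
  have hle : h a' ≤ h a := h_antitoneOn ha ha' haa'
  rw [abs_of_nonneg (sub_nonneg.2 hle)] at hgap
  obtain ⟨b, hb, ⟨hb1, hb2⟩, q, hq, hq1, hq0, hqmin⟩ :=
    exists_isTentPeriod_between m n hha'.1 hha.2 hgap
  refine ⟨b, hb, q, hq1, hq, hq0, hqmin, ?_⟩
  rintro x ⟨hx, hxb⟩
  constructor
  · by_contra hn
    have := h_antitoneOn hx ha (not_le.1 hn).le
    linarith
  · by_contra hn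
    have := h_antitoneOn ha' hx (not_le.1 hn).le
    linarith
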